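/- Let (A^{(t)}, t ∈ [T]) follow the lazy IER process on [n] with mean matrix P and laziness parameter α ∈ (0,1). Let A = Σ_{t=1}^T A^{(t)}, D the diagonal matrix of aggregated degrees, 𝓛 = I_n − D^{−1/2} A D^{−1/2}, and 𝓛̄ = I_n − D̄^{−1/2} Ā D̄^{−1/2} with Ā = E A, D̄ = E D. For any constant c > 0 there exists a constant C = C(c) > 0 (independent of n, T, P, α) such that: if T·d_min > C(log n)^3, then there is a constant C₂ = C₂(α) such that for every δ ∈ (n^{-c}, 1/2), with probability at least 1 − δ, ‖𝓛 − 𝓛̄‖ ≤ C₂ √(log(4n/δ) / (T · d_min)). -/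

import Mathlib

open MeasureTheory ProbabilityTheory Finset Real

noncomputable section

/-- Value of the Bernoulli(p) pmf at `b`. -/
def bernProb (p : ℝ) (b : Bool) : ℝ := if b then p else 1 - p

/-- One-step transition probability of a lazy Bernoulli edge process:
with probability `α` keep the previous state, with probability `1 - α`
resample from Bernoulli(p). -/
def lazyStep (p α : ℝ) (prev next : Bool) : ℝ :=
  (if next = prev then α else 0) + (1 - α) * bernProb p next

/-- Probability of observing the trajectory `m` (at times `1, …, T`) under the
lazy IER process with mean matrix `P` and laziness parameter `α`:
edges (pairs `i ≤ j`) evolve independently, each as a lazy Bernoulli chain. -/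
def lazyTrajProb (n T : ℕ) (P : Matrix (Fin n) (Fin n) ℝ) (α : ℝ)
    (m : ℕ → Fin n → Fin n → Bool) : ℝ :=
  ∏ ij ∈ Finset.univ.filter (fun ij : Fin n × Fin n => ij.1 ≤ ij.2),
    (bernProb (P ij.1 ij.2) (m 1 ij.1 ij.2) *
      ∏ t ∈ Finset.Icc 2 T, lazyStep (P ij.1 ij.2) α (m (t-1) ij.1 ij.2) (m t ij.1 ij.2))

/-- `A` (whose relevant time indices are `1, …, T`) is a lazy inhomogeneous
Erdős–Rényi process on the probability space `(Ω, μ)` with symmetric mean matrix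
`P ∈ [0,1]^{n×n}` and laziness parameter `α ∈ (0,1)`. -/
structure IsLazyIER {Ω : Type} [MeasurableSpace Ω] (μ : Measure Ω)
    (n T : ℕ) (P : Matrix (Fin n) (Fin n) ℝ) (α : ℝ)
    (A : ℕ → Ω → Fin n → Fin n → Bool) : Prop where
  prob : IsProbabilityMeasure μ
  two_le_T : 2 ≤ T
  alpha_mem : α ∈ Set.Ioo (0 : ℝ) 1
  P_symm : ∀ i j, P i j = P j i
  P_mem : ∀ i j, P i j ∈ Set.Icc (0 : ℝ) 1
  A_symm : ∀ t ω i j, A t ω i j = A t ω j i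
  meas : ∀ t, Measurable (A t)
  law : ∀ m : ℕ → Fin n → Fin n → Bool, (∀ t i j, m t i j = m t j i) →
    (μ {ω | ∀ t ∈ Finset.Icc 1 T, A t ω = m t}).toReal = lazyTrajProb n T P α m

/-- Entry `(i,j)` of the aggregated adjacency matrix `A = Σ_{t=1}^T A^{(t)}`. -/
def aggE {Ω : Type} (n T : ℕ) (A : ℕ → Ω → Fin n → Fin n → Bool)
    (ω : Ω) (i j : Fin n) : ℝ :=
  ∑ t ∈ Finset.Icc 1 T, if A t ω i j then (1 : ℝ) else 0

/-- The aggregated adjacency matrix as a random matrix. -/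
def aggMatrix {Ω : Type} (n T : ℕ) (A : ℕ → Ω → Fin n → Fin n → Bool)
    (ω : Ω) : Matrix (Fin n) (Fin n) ℝ :=
  Matrix.of fun i j => aggE n T A ω i j

/-- Entrywise expectation `Ā = E A` of the aggregated adjacency matrix. -/
def aggMean {Ω : Type} [MeasurableSpace Ω] (μ : Measure Ω)
    (n T : ℕ) (A : ℕ → Ω → Fin n → Fin n → Bool) : Matrix (Fin n) (Fin n) ℝ :=
  Matrix.of fun i j => ∫ ω, aggE n T A ω i j ∂μ

/-- The operator (spectral) norm of a real matrix, i.e. the norm of the induced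
linear map between Euclidean spaces. -/
def opNorm {k l : ℕ} (M : Matrix (Fin k) (Fin l) ℝ) : ℝ :=
  ‖LinearMap.toContinuousLinearMap (Matrix.toEuclideanLin M)‖

/-- Maximum expected degree `d_max = max_i Σ_j p_ij`. -/
def dMax {n : ℕ} (P : Matrix (Fin n) (Fin n) ℝ) : ℝ := ⨆ i, ∑ j, P i j

/-- Minimum expected degree `d_min = min_i Σ_j p_ij`. -/
def dMin {n : ℕ} (P : Matrix (Fin n) (Fin n) ℝ) : ℝ := ⨅ i, ∑ j, P i j

/-- Aggregated degree `d_i = Σ_{t∈[T], j∈[n]} A^{(t)}_{ij}` of vertex `i`. -/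
def aggDeg {Ω : Type} (n T : ℕ) (A : ℕ → Ω → Fin n → Fin n → Bool)
    (ω : Ω) (i : Fin n) : ℝ :=
  ∑ j, aggE n T A ω i j

/-- The aggregated Laplacian `𝓛 = I - D^{-1/2} A D^{-1/2}`. -/
def aggLap {Ω : Type} (n T : ℕ) (A : ℕ → Ω → Fin n → Fin n → Bool)
    (ω : Ω) : Matrix (Fin n) (Fin n) ℝ :=
  1 - Matrix.of fun i j =>
    aggE n T A ω i j / (Real.sqrt (aggDeg n T A ω i) * Real.sqrt (aggDeg n T A ω j))

/-- Expected aggregated degree `d̄_i`. -/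
def aggMeanDeg {Ω : Type} [MeasurableSpace Ω] (μ : Measure Ω)
    (n T : ℕ) (A : ℕ → Ω → Fin n → Fin n → Bool) (i : Fin n) : ℝ :=
  ∑ j, aggMean μ n T A i j

/-- The population Laplacian `𝓛̄ = I - D̄^{-1/2} Ā D̄^{-1/2}`. -/
def aggLapMean {Ω : Type} [MeasurableSpace Ω] (μ : Measure Ω)
    (n T : ℕ) (A : ℕ → Ω → Fin n → Fin n → Bool) : Matrix (Fin n) (Fin n) ℝ :=
  1 - Matrix.of fun i j =>
    aggMean μ n T A i j /
      (Real.sqrt (aggMeanDeg μ n T A i) * Real.sqrt (aggMeanDeg μ n T A j))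

section TraceInequalities

variable {ι : Type*} [Fintype ι]

theorem abs_trace_mul_self_le (M : Matrix ι ι ℝ) :
    |(M * M).trace| ≤ (M * M.transpose).trace := by
  have h : ∀ s : ℝ, s ^ 2 = 1 → s * (M * M).trace ≤ (M * M.transpose).trace := by
    intro s hs
    have h1 : (M * M.transpose).trace = ∑ i, ∑ j, M i j ^ 2 := by
      simp [Matrix.trace, Matrix.mul_apply, sq]
    have h2 : (M * M.transpose).trace = ∑ i, ∑ j, M j i ^ 2 := by
      rw [h1, Finset.sum_comm]
    have h3 : s * (M * M).trace = ∑ i, ∑ j, s * (M i j * M j i) := by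
      simp [Matrix.trace, Matrix.mul_apply, Finset.mul_sum]
    have h4 : 2 * (s * (M * M).trace) ≤ (M * M.transpose).trace + (M * M.transpose).trace := by
      nth_rewrite 1 [h1]
      rw [h2, h3, ← Finset.sum_add_distrib, Finset.mul_sum]
      refine Finset.sum_le_sum fun i _ => ?_
      rw [← Finset.sum_add_distrib, Finset.mul_sum]
      refine Finset.sum_le_sum fun j _ => ?_
      nlinarith [sq_nonneg (M i j - s * M j i)]
    linarith
  rw [abs_le]
  have := h 1 (by norm_num)
  have := h (-1) (by norm_num)
  constructor <;> linarith

theorem trace_mul_le_of_isSymm {X Y : Matrix ι ι ℝ} (hX : X.IsSymm) (hY : Y.IsSymm) :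
    (X * Y).trace ≤ ((X * X).trace + (Y * Y).trace) / 2 := by
  have e : ∀ {X Y : Matrix ι ι ℝ}, Y.IsSymm → (X * Y).trace = ∑ i, ∑ j, X i j * Y i j := by
    intro X Y hY
    simp only [Matrix.trace, Matrix.mul_apply, Matrix.diag_apply]
    exact Finset.sum_congr rfl fun i _ => Finset.sum_congr rfl fun j _ => by rw [hY.apply i j]
  rw [e hY, e hX, e hY, ← Finset.sum_add_distrib, Finset.sum_div]
  refine Finset.sum_le_sum fun i _ => ?_
  rw [← Finset.sum_add_distrib, Finset.sum_div]
  refine Finset.sum_le_sum fun j _ => ?_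
  nlinarith [sq_nonneg (X i j - Y i j)]

variable [DecidableEq ι]

theorem Matrix.trace_mul_pow_comm (X Y : Matrix ι ι ℝ) (k : ℕ) :
    ((X * Y) ^ k).trace = ((Y * X) ^ k).trace := by
  cases k with
  | zero => simp
  | succ k =>
    have h : (X * Y) ^ (k + 1) = X * ((Y * X) ^ k * Y) := by
      have : SemiconjBy X ((Y * X) ^ k) ((X * Y) ^ k) := by
        apply SemiconjBy.pow_right
        simp [SemiconjBy, mul_assoc]
      rw [pow_succ, ← mul_assoc, ← mul_assoc, this.eq]
    rw [h, Matrix.trace_mul_comm, pow_succ, mul_assoc]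

theorem trace_mul_pow_two_pow_le_aux (k : ℕ)
    (hw : ∀ j < k, ∀ M : Matrix ι ι ℝ,
      |(M ^ 2 ^ (j + 1)).trace| ≤ ((M * M.transpose) ^ 2 ^ j).trace)
    {P Q : Matrix ι ι ℝ} (hP : P.IsSymm) (hQ : Q.IsSymm) :
    ((P * Q) ^ 2 ^ k).trace ≤ (P ^ 2 ^ k * Q ^ 2 ^ k).trace := by
  induction k generalizing P Q with
  | zero => simp
  | succ k ih =>
    have h1 := (le_abs_self _).trans (hw k (Nat.lt_succ_self k) (P * Q))
    have h2 : ((P * Q * (P * Q).transpose) ^ 2 ^ k).trace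
        = (((P ^ 2) * (Q ^ 2)) ^ 2 ^ k).trace := by
      rw [Matrix.transpose_mul, hP.eq, hQ.eq, sq, sq,
        show P * Q * (Q * P) = (P * (Q * Q)) * P by simp only [mul_assoc],
        Matrix.trace_mul_pow_comm, ← mul_assoc]
    refine h1.trans (h2.trans_le ?_)
    refine (ih (fun j hj => hw j (hj.trans (Nat.lt_succ_self k))) (hP.pow 2) (hQ.pow 2)).trans_eq ?_
    rw [← pow_mul, ← pow_mul, ← pow_succ']

/-- A special case of Weyl's majorant inequality for traces of powers. -/
theorem abs_trace_pow_two_pow_le (k : ℕ) (M : Matrix ι ι ℝ) :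
    |(M ^ 2 ^ (k + 1)).trace| ≤ ((M * M.transpose) ^ 2 ^ k).trace := by
  induction k using Nat.strong_induction_on generalizing M with
  | _ k ih =>
    cases k with
    | zero => simpa [sq] using abs_trace_mul_self_le M
    | succ k =>
      have h1 := ih k (Nat.lt_succ_self k) (M * M)
      have h2 : ((M * M * (M * M).transpose) ^ 2 ^ k).trace
          = (((M.transpose * M) * (M * M.transpose)) ^ 2 ^ k).trace := by
        rw [Matrix.transpose_mul,
          show M * M * (M.transpose * M.transpose) = (M * (M * M.transpose)) * M.transpose by
            simp only [mul_assoc],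
          Matrix.trace_mul_pow_comm, ← mul_assoc]
      have hP : (M.transpose * M).IsSymm := Matrix.isSymm_transpose_mul_self M
      have hQ : (M * M.transpose).IsSymm := Matrix.isSymm_mul_transpose_self M
      have h3 := trace_mul_pow_two_pow_le_aux k
        (fun j hj => ih j (hj.trans (Nat.lt_succ_self k))) hP hQ
      have h4 := trace_mul_le_of_isSymm (hP.pow (2 ^ k)) (hQ.pow (2 ^ k))
      rw [← pow_add, ← pow_add, Matrix.trace_mul_pow_comm, ← two_mul (2 ^ k), ← pow_succ'] at h4
      rw [← sq, ← pow_mul, ← pow_succ'] at h1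
      rw [← sq] at h2
      linarith

theorem trace_mul_pow_two_pow_le {P Q : Matrix ι ι ℝ} (hP : P.IsSymm) (hQ : Q.IsSymm) (k : ℕ) :
    ((P * Q) ^ 2 ^ k).trace ≤ (P ^ 2 ^ k * Q ^ 2 ^ k).trace :=
  trace_mul_pow_two_pow_le_aux k (fun j _ => abs_trace_pow_two_pow_le j) hP hQ

end TraceInequalities

section LieProduct

theorem norm_pow_sub_pow_le {𝔸 : Type*} [NormedRing 𝔸] [NormOneClass 𝔸] {X Y : 𝔸} {r : ℝ}
    (hX : ‖X‖ ≤ r) (hY : ‖Y‖ ≤ r) (k : ℕ) :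
    ‖X ^ (k + 1) - Y ^ (k + 1)‖ ≤ (k + 1) * r ^ k * ‖X - Y‖ := by
  have hr : 0 ≤ r := (norm_nonneg _).trans hX
  induction k with
  | zero => simp
  | succ k ih =>
    have h : X ^ (k + 1 + 1) - Y ^ (k + 1 + 1)
        = X ^ (k + 1) * (X - Y) + (X ^ (k + 1) - Y ^ (k + 1)) * Y := by
      rw [pow_succ X (k + 1), pow_succ Y (k + 1)]; noncomm_ring
    rw [h]
    have h1 : ‖X ^ (k + 1) * (X - Y)‖ ≤ r ^ (k + 1) * ‖X - Y‖ :=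
      (norm_mul_le _ _).trans (by
        gcongr
        exact (norm_pow_le _ _).trans (by gcongr))
    have h2 : ‖(X ^ (k + 1) - Y ^ (k + 1)) * Y‖ ≤ (k + 1) * r ^ k * ‖X - Y‖ * r :=
      (norm_mul_le _ _).trans (by gcongr)
    refine (norm_add_le _ _).trans ((add_le_add h1 h2).trans_eq ?_)
    push_cast
    ring

theorem norm_normedSpace_exp_le {𝔸 : Type*} [NormedRing 𝔸] [NormedAlgebra ℝ 𝔸] [NormOneClass 𝔸]
    [CompleteSpace 𝔸] (x : 𝔸) : ‖NormedSpace.exp x‖ ≤ Real.exp ‖x‖ := by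
  have h := NormedSpace.expSeries_div_hasSum_exp ‖x‖
  rw [← Real.exp_eq_exp_ℝ] at h
  rw [NormedSpace.exp_eq_tsum (𝕂 := ℝ)]
  refine tsum_of_norm_bounded h fun k => ?_
  rw [norm_smul, norm_inv, RCLike.norm_natCast, div_eq_inv_mul]
  gcongr
  exact norm_pow_le _ _

open Filter Topology in
/-- The **Lie product formula** along powers of two. -/
theorem tendsto_exp_mul_exp_pow {𝔸 : Type*} [NormedRing 𝔸] [NormedAlgebra ℝ 𝔸] [NormOneClass 𝔸]
    [CompleteSpace 𝔸] (A B : 𝔸) :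
    Tendsto (fun k : ℕ => (NormedSpace.exp ((1 / (k + 1 : ℝ)) • A) *
      NormedSpace.exp ((1 / (k + 1 : ℝ)) • B)) ^ (k + 1)) atTop (𝓝 (NormedSpace.exp (A + B))) := by
  let _ : NormedAlgebra ℚ 𝔸 := NormedAlgebra.restrictScalars ℚ ℝ 𝔸
  set f : ℝ → 𝔸 := fun t => NormedSpace.exp (t • A) * NormedSpace.exp (t • B)
    - NormedSpace.exp (t • (A + B)) with hf
  have hd : HasDerivAt f 0 0 := by
    have hA := hasDerivAt_exp_smul_const (𝕂 := ℝ) A (0 : ℝ)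
    have hB := hasDerivAt_exp_smul_const (𝕂 := ℝ) B (0 : ℝ)
    have hAB := hasDerivAt_exp_smul_const (𝕂 := ℝ) (A + B) (0 : ℝ)
    convert! (hA.mul hB).sub hAB using 1
    simp
  have hu : Tendsto (fun k : ℕ => 1 / ((k : ℝ) + 1)) atTop (𝓝 0) :=
    tendsto_one_div_add_atTop_nhds_zero_nat
  have hlim : Tendsto (fun k : ℕ => ((k : ℝ) + 1) * ‖f (1 / ((k : ℝ) + 1))‖) atTop (𝓝 0) := by
    have h0 : f 0 = 0 := by simp [hf]
    have := (hasDerivAt_iff_tendsto.1 hd).comp hu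
    refine this.congr fun k => ?_
    simp only [Function.comp, h0, sub_zero, smul_zero, Real.norm_eq_abs]
    have : (0 : ℝ) < (k : ℝ) + 1 := by positivity
    rw [abs_of_pos (by positivity)]
    simp
  have hbound : ∀ (M : 𝔸) (t : ℝ), 0 ≤ t → ‖NormedSpace.exp (t • M)‖ ≤ Real.exp (t * ‖M‖) := by
    intro M t ht
    refine (norm_normedSpace_exp_le _).trans_eq ?_
    rw [norm_smul, Real.norm_of_nonneg ht]
  set R := ‖A‖ + ‖B‖ with hR
  rw [tendsto_iff_norm_sub_tendsto_zero]
  have hmaj : Tendsto (fun k : ℕ => Real.exp R * (((k : ℝ) + 1) * ‖f (1 / ((k : ℝ) + 1))‖))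
      atTop (𝓝 0) := by simpa using hlim.const_mul (Real.exp R)
  refine squeeze_zero (fun _ => norm_nonneg _) (fun k => ?_) hmaj
  have hk : (0 : ℝ) < (k : ℝ) + 1 := by positivity
  set t : ℝ := 1 / ((k : ℝ) + 1) with ht
  have ht0 : 0 ≤ t := by positivity
  have hE : NormedSpace.exp (A + B) = NormedSpace.exp (t • (A + B)) ^ (k + 1) := by
    rw [← NormedSpace.exp_nsmul, ← Nat.cast_smul_eq_nsmul ℝ, smul_smul]
    push_cast
    rw [ht, mul_one_div_cancel hk.ne', one_smul]
  have hX : ‖NormedSpace.exp (t • A) * NormedSpace.exp (t • B)‖ ≤ Real.exp (t * R) := by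
    refine (norm_mul_le _ _).trans ?_
    rw [hR, mul_add, Real.exp_add]
    gcongr
    · exact hbound A t ht0
    · exact hbound B t ht0
  have hY : ‖NormedSpace.exp (t • (A + B))‖ ≤ Real.exp (t * R) :=
    (hbound _ t ht0).trans (by gcongr; exact norm_add_le _ _)
  rw [hE]
  refine (norm_pow_sub_pow_le hX hY k).trans ?_
  have hpow : Real.exp (t * R) ^ k ≤ Real.exp R := by
    rw [← Real.exp_nat_mul]
    apply Real.exp_le_exp.2
    have hR0 : 0 ≤ R := by positivity
    have : (k : ℝ) * t ≤ 1 := by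
      rw [ht, mul_one_div, div_le_one hk]; linarith
    calc (k : ℝ) * (t * R) = (k * t) * R := by ring
      _ ≤ 1 * R := by gcongr
      _ = R := one_mul R
  have hfn : 0 ≤ ‖f t‖ := norm_nonneg _
  calc ((k : ℝ) + 1) * Real.exp (t * R) ^ k * ‖f t‖
      ≤ ((k : ℝ) + 1) * Real.exp R * ‖f t‖ := by gcongr
    _ = _ := by ring

end LieProduct

section TraceExp

variable {ι : Type*} [Fintype ι] [DecidableEq ι]

open Filter Topology Matrix in
open scoped Matrix.Norms.L2Operator in
/-- The **Golden–Thompson inequality** for real symmetric matrices. -/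
theorem trace_exp_add_le {A B : Matrix ι ι ℝ} (hA : A.IsSymm) (hB : B.IsSymm) :
    (NormedSpace.exp (A + B)).trace ≤ (NormedSpace.exp A * NormedSpace.exp B).trace := by
  cases isEmpty_or_nonempty ι with
  | inl h => simp [Matrix.trace]
  | inr h =>
    let _ : NormedAlgebra ℚ (Matrix ι ι ℝ) := NormedAlgebra.restrictScalars ℚ ℝ _
    have hone : NormOneClass (Matrix ι ι ℝ) := inferInstance
    have h2 : Tendsto (fun k : ℕ => 2 ^ k - 1) atTop atTop :=
      (tendsto_sub_atTop_nat 1).comp (tendsto_pow_atTop_atTop_of_one_lt (by norm_num))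
    have h1 := (tendsto_exp_mul_exp_pow A B).comp h2
    have h3 : Continuous (fun M : Matrix ι ι ℝ => M.trace) := continuous_id.matrix_trace
    refine le_of_tendsto ((h3.tendsto _).comp h1) (Eventually.of_forall fun k => ?_)
    have hk : 2 ^ k - 1 + 1 = 2 ^ k := Nat.sub_add_cancel Nat.one_le_two_pow
    have hk' : ((2 ^ k - 1 : ℕ) : ℝ) + 1 = 2 ^ k := by exact_mod_cast hk
    have hsc : ∀ M : Matrix ι ι ℝ,
        NormedSpace.exp ((1 / (2 : ℝ) ^ k) • M) ^ 2 ^ k = NormedSpace.exp M := by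
      intro M
      rw [← NormedSpace.exp_nsmul, ← Nat.cast_smul_eq_nsmul ℝ, smul_smul]
      push_cast
      rw [mul_one_div_cancel (by positivity), one_smul]
    simp only [Function.comp, hk, hk']
    refine (trace_mul_pow_two_pow_le (hA.smul _).exp (hB.smul _).exp k).trans_eq ?_
    rw [hsc, hsc]

theorem Matrix.IsSymm.exists_orthogonal_diagonalization {A : Matrix ι ι ℝ} (hA : A.IsSymm) :
    ∃ (U : Matrix ι ι ℝ) (l : ι → ℝ), U.transpose * U = 1 ∧ U * U.transpose = 1 ∧
      A = U * Matrix.diagonal l * U.transpose := by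
  have hA' : A.IsHermitian := by
    rw [Matrix.IsHermitian, Matrix.conjTranspose_eq_transpose_of_trivial]; exact hA
  refine ⟨hA'.eigenvectorUnitary, hA'.eigenvalues, ?_, ?_, ?_⟩
  · have := Unitary.coe_star_mul_self hA'.eigenvectorUnitary
    rwa [Matrix.star_eq_conjTranspose, Matrix.conjTranspose_eq_transpose_of_trivial] at this
  · have := Unitary.coe_mul_star_self hA'.eigenvectorUnitary
    rwa [Unitary.coe_star, Matrix.star_eq_conjTranspose,
      Matrix.conjTranspose_eq_transpose_of_trivial] at this
  · have := hA'.spectral_theorem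
    rw [Unitary.conjStarAlgAut_apply, Matrix.star_eq_conjTranspose,
      Matrix.conjTranspose_eq_transpose_of_trivial] at this
    exact this

theorem exp_orthogonal_conj {U : Matrix ι ι ℝ} (hU : U.transpose * U = 1)
    (hU' : U * U.transpose = 1) (l : ι → ℝ) :
    NormedSpace.exp (U * Matrix.diagonal l * U.transpose)
      = U * Matrix.diagonal (fun i => Real.exp (l i)) * U.transpose := by
  have hinv : U⁻¹ = U.transpose := Matrix.inv_eq_left_inv hU
  have hu : IsUnit U := ⟨⟨U, U.transpose, hU', hU⟩, rfl⟩
  rw [← hinv, Matrix.exp_conj U _ hu, Matrix.exp_diagonal]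
  congr 3
  ext i
  rw [Pi.coe_exp, Real.exp_eq_exp_ℝ]

theorem trace_mul_orthogonal_conj (E U : Matrix ι ι ℝ) (g : ι → ℝ) :
    (E * (U * Matrix.diagonal g * U.transpose)).trace
      = ∑ k, (U.transpose * E * U) k k * g k := by
  rw [← mul_assoc, Matrix.trace_mul_comm, ← mul_assoc, ← mul_assoc]
  simp [Matrix.trace, Matrix.mul_diagonal]

theorem transpose_mul_exp_mul_self_nonneg {A : Matrix ι ι ℝ} (hA : A.IsSymm) (U : Matrix ι ι ℝ)
    (k : ι) : 0 ≤ (U.transpose * NormedSpace.exp A * U) k k := by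
  obtain ⟨V, l, hV, hV', rfl⟩ := hA.exists_orthogonal_diagonalization
  rw [exp_orthogonal_conj hV hV']
  have : U.transpose * (V * Matrix.diagonal (fun i => Real.exp (l i)) * V.transpose) * U
      = (V.transpose * U).transpose * Matrix.diagonal (fun i => Real.exp (l i))
        * (V.transpose * U) := by
    rw [Matrix.transpose_mul, Matrix.transpose_transpose]
    simp only [mul_assoc]
  rw [this, Matrix.mul_apply]
  refine Finset.sum_nonneg fun i _ => ?_
  rw [Matrix.mul_diagonal, Matrix.transpose_apply]
  nlinarith [mul_nonneg (sq_nonneg ((V.transpose * U) i k)) (Real.exp_pos (l i)).le]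

theorem trace_exp_nonneg {A : Matrix ι ι ℝ} (hA : A.IsSymm) :
    0 ≤ (NormedSpace.exp A).trace := by
  have := fun k => transpose_mul_exp_mul_self_nonneg hA 1 k
  simp only [Matrix.transpose_one, one_mul, mul_one] at this
  exact Finset.sum_nonneg fun k _ => this k

theorem dotProduct_orthogonal_conj (U : Matrix ι ι ℝ) (l : ι → ℝ) (v : ι → ℝ) :
    v ⬝ᵥ ((U * Matrix.diagonal l * U.transpose).mulVec v)
      = ∑ k, l k * (U.transpose.mulVec v k) ^ 2 := by
  rw [← Matrix.mulVec_mulVec, ← Matrix.mulVec_mulVec, Matrix.dotProduct_mulVec,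
    ← Matrix.mulVec_transpose]
  simp only [dotProduct, Matrix.mulVec_diagonal]
  exact Finset.sum_congr rfl fun k _ => by ring

theorem exp_le_trace_exp {M : Matrix ι ι ℝ} (hM : M.IsSymm) {t : ℝ} {v : ι → ℝ}
    (hv : t * (v ⬝ᵥ v) < v ⬝ᵥ (M.mulVec v)) : Real.exp t ≤ (NormedSpace.exp M).trace := by
  obtain ⟨U, l, hU, hU', rfl⟩ := hM.exists_orthogonal_diagonalization
  have h1 : v ⬝ᵥ v = ∑ k, (U.transpose.mulVec v k) ^ 2 := by
    have := dotProduct_orthogonal_conj U (fun _ => (1 : ℝ)) v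
    simpa [hU'] using this
  rw [dotProduct_orthogonal_conj, h1, Finset.mul_sum] at hv
  obtain ⟨k, -, hk⟩ := Finset.exists_lt_of_sum_lt hv
  have hlk : t ≤ l k := by
    by_contra h
    push Not at h
    nlinarith [mul_le_mul_of_nonneg_right h.le (sq_nonneg (U.transpose.mulVec v k))]
  rw [exp_orthogonal_conj hU hU', Matrix.trace_mul_comm, ← mul_assoc, hU, one_mul,
    Matrix.trace_diagonal]
  exact (Real.exp_le_exp.2 hlk).trans
    (Finset.single_le_sum (f := fun i => Real.exp (l i)) (fun i _ => (Real.exp_pos _).le)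
      (Finset.mem_univ k))

theorem sum_trace_exp_add_le {X : Type*} [Fintype X] {w s : X → ℝ} (hw : ∀ x, 0 ≤ w x) {κ r : ℝ}
    (hmgf : ∀ l : ℝ, |l| ≤ r → ∑ x, w x * Real.exp (s x * l - κ * l ^ 2) ≤ 1)
    {A H : Matrix ι ι ℝ} (hA : A.IsSymm) (hH : H.IsSymm)
    (hr : ∀ v, |v ⬝ᵥ (H.mulVec v)| ≤ r * (v ⬝ᵥ v)) :
    ∑ x, w x * (NormedSpace.exp (A + (s x • H - κ • (H * H)))).trace
      ≤ (NormedSpace.exp A).trace := by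
  obtain ⟨U, l, hU, hU', hHU⟩ := hH.exists_orthogonal_diagonalization
  have hl : ∀ k, |l k| ≤ r := by
    intro k
    have h := hr (U.mulVec (Pi.single k 1))
    have e : U.transpose.mulVec (U.mulVec (Pi.single k 1)) = Pi.single k 1 := by
      rw [Matrix.mulVec_mulVec, hU, Matrix.one_mulVec]
    have h2 : U.mulVec (Pi.single k 1) ⬝ᵥ U.mulVec (Pi.single k 1) = 1 := by
      rw [Matrix.dotProduct_mulVec, ← Matrix.mulVec_transpose, e]
      simp
    rw [hHU, dotProduct_orthogonal_conj, e, h2] at h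
    simpa [Pi.single_apply] using h
  have hHH : H * H = U * Matrix.diagonal (fun i => l i ^ 2) * U.transpose := by
    rw [hHU, show U * Matrix.diagonal l * U.transpose * (U * Matrix.diagonal l * U.transpose)
      = U * Matrix.diagonal l * (U.transpose * U) * (Matrix.diagonal l * U.transpose) by
        simp only [mul_assoc], hU, mul_one, ← mul_assoc, mul_assoc U, Matrix.diagonal_mul_diagonal]
    simp only [sq]
  have hD : ∀ x, s x • H - κ • (H * H)
      = U * Matrix.diagonal (fun i => s x * l i - κ * l i ^ 2) * U.transpose := by
    intro x
    have : Matrix.diagonal (fun i => s x * l i - κ * l i ^ 2)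
        = s x • Matrix.diagonal l - κ • Matrix.diagonal (fun i => l i ^ 2) := by
      rw [← Matrix.diagonal_smul, ← Matrix.diagonal_smul, Matrix.diagonal_sub]
      rfl
    rw [this, hHH, mul_sub, sub_mul, mul_smul_comm, mul_smul_comm, smul_mul_assoc, smul_mul_assoc,
      ← hHU]
  have hsymm : ∀ x, (s x • H - κ • (H * H)).IsSymm := fun x =>
    (hH.smul _).sub (Matrix.IsSymm.smul (by rw [← sq]; exact hH.pow 2) _)
  set c : ι → ℝ := fun k => (U.transpose * NormedSpace.exp A * U) k k with hc
  have hc0 : ∀ k, 0 ≤ c k := transpose_mul_exp_mul_self_nonneg hA U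
  calc ∑ x, w x * (NormedSpace.exp (A + (s x • H - κ • (H * H)))).trace
      ≤ ∑ x, w x * ∑ k, c k * Real.exp (s x * l k - κ * l k ^ 2) := by
        refine Finset.sum_le_sum fun x _ => mul_le_mul_of_nonneg_left ?_ (hw x)
        refine (trace_exp_add_le hA (hsymm x)).trans_eq ?_
        rw [hD, exp_orthogonal_conj hU hU', trace_mul_orthogonal_conj]
    _ = ∑ k, c k * ∑ x, w x * Real.exp (s x * l k - κ * l k ^ 2) := by
        simp only [Finset.mul_sum]
        rw [Finset.sum_comm]
        exact Finset.sum_congr rfl fun k _ => Finset.sum_congr rfl fun x _ => by ring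
    _ ≤ ∑ k, c k * 1 := Finset.sum_le_sum fun k _ =>
        mul_le_mul_of_nonneg_left (hmgf _ (hl k)) (hc0 k)
    _ = (NormedSpace.exp A).trace := by
        have := trace_mul_orthogonal_conj (NormedSpace.exp A) U (fun _ => (1 : ℝ))
        simpa [hU'] using this.symm

theorem sum_fin_prod_trace_exp_le {X : Type*} [Fintype X] {N : ℕ} {w s : Fin N → X → ℝ}
    (hw : ∀ e x, 0 ≤ w e x) {κ : Fin N → ℝ} {r : ℝ}
    (hmgf : ∀ e, ∀ l : ℝ, |l| ≤ r → ∑ x, w e x * Real.exp (s e x * l - κ e * l ^ 2) ≤ 1)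
    {H : Fin N → Matrix ι ι ℝ} (hH : ∀ e, (H e).IsSymm)
    (hr : ∀ e v, |v ⬝ᵥ ((H e).mulVec v)| ≤ r * (v ⬝ᵥ v))
    {B : Matrix ι ι ℝ} (hB : B.IsSymm) :
    ∑ x : Fin N → X, (∏ e, w e (x e)) *
        (NormedSpace.exp (B + ∑ e, (s e (x e) • H e - κ e • (H e * H e)))).trace
      ≤ (NormedSpace.exp B).trace := by
  induction N generalizing B with
  | zero => simp
  | succ N ih =>
    rw [← (Fin.consEquiv fun _ => X).sum_comp, Fintype.sum_prod_type]
    simp only [Fin.consEquiv_apply, Fin.prod_univ_succ, Fin.sum_univ_succ, Fin.cons_zero,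
      Fin.cons_succ]
    have hsymm : ∀ x, (s 0 x • H 0 - κ 0 • (H 0 * H 0)).IsSymm := fun x =>
      ((hH 0).smul _).sub (Matrix.IsSymm.smul (by rw [← sq]; exact (hH 0).pow 2) _)
    refine le_trans (Finset.sum_le_sum fun x _ => ?_)
      (sum_trace_exp_add_le (hw 0) (hmgf 0) hB (hH 0) (hr 0))
    have := ih (w := fun e => w e.succ) (s := fun e => s e.succ) (fun e => hw e.succ)
      (fun e => hmgf e.succ) (fun e => hH e.succ) (fun e => hr e.succ) (hB.add (hsymm x))
    refine le_trans (le_of_eq ?_) (mul_le_mul_of_nonneg_left this (hw 0 x))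
    rw [Finset.mul_sum]
    refine Finset.sum_congr rfl fun y _ => ?_
    rw [mul_assoc, add_assoc]

theorem sum_prod_trace_exp_le {E X : Type*} [Fintype E] [DecidableEq E] [Fintype X]
    {w s : E → X → ℝ} (hw : ∀ e x, 0 ≤ w e x) {κ : E → ℝ} {r : ℝ}
    (hmgf : ∀ e, ∀ l : ℝ, |l| ≤ r → ∑ x, w e x * Real.exp (s e x * l - κ e * l ^ 2) ≤ 1)
    {H : E → Matrix ι ι ℝ} (hH : ∀ e, (H e).IsSymm)
    (hr : ∀ e v, |v ⬝ᵥ ((H e).mulVec v)| ≤ r * (v ⬝ᵥ v)) :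
    ∑ x : E → X, (∏ e, w e (x e)) *
        (NormedSpace.exp (∑ e, (s e (x e) • H e - κ e • (H e * H e)))).trace
      ≤ Fintype.card ι := by
  have φ := (Fintype.equivFin E).symm
  have := sum_fin_prod_trace_exp_le (w := fun e => w (φ e)) (s := fun e => s (φ e))
    (fun e => hw (φ e)) (fun e => hmgf (φ e)) (fun e => hH (φ e)) (fun e => hr (φ e))
    (Matrix.isSymm_zero)
  rw [← (Equiv.arrowCongr φ.symm (Equiv.refl X)).sum_comp] at this
  simp only [Equiv.arrowCongr_apply, Equiv.coe_refl, Function.comp_def, Equiv.symm_symm, id,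
    zero_add, NormedSpace.exp_zero, Matrix.trace_one] at this
  refine le_trans (le_of_eq ?_) this
  refine Finset.sum_congr rfl fun x _ => ?_
  rw [← φ.prod_comp, ← φ.sum_comp]

/-- Upper tail bound for the largest eigenvalue of a sum of independent random symmetric matrices
of the form `s e • H e`, where each scalar `s e` has a subexponential moment generating function. -/
theorem sum_prod_filter_le {E X : Type*} [Fintype E] [DecidableEq E] [Fintype X]
    {w s : E → X → ℝ} (hw : ∀ e x, 0 ≤ w e x) {κ : E → ℝ} {r : ℝ}
    (hmgf : ∀ e, ∀ l : ℝ, |l| ≤ r → ∑ x, w e x * Real.exp (s e x * l - κ e * l ^ 2) ≤ 1)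
    {H : E → Matrix ι ι ℝ} (hH : ∀ e, (H e).IsSymm)
    (hr : ∀ e v, |v ⬝ᵥ ((H e).mulVec v)| ≤ r * (v ⬝ᵥ v)) {ρ : ℝ}
    (hρ : ∀ v, ∑ e, κ e * (v ⬝ᵥ ((H e * H e).mulVec v)) ≤ ρ * (v ⬝ᵥ v)) {t : ℝ}
    {bad : Finset (E → X)}
    (hbad : ∀ x ∈ bad, ∃ v, t * (v ⬝ᵥ v) < v ⬝ᵥ ((∑ e, s e (x e) • H e).mulVec v)) :
    ∑ x ∈ bad, ∏ e, w e (x e) ≤ Fintype.card ι * Real.exp (ρ - t) := by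
  have hsymm : ∀ x : E → X, (∑ e, (s e (x e) • H e - κ e • (H e * H e))).IsSymm := by
    intro x
    rw [Matrix.IsSymm, Matrix.transpose_sum]
    refine Finset.sum_congr rfl fun e _ => ?_
    exact ((hH e).smul _).sub (Matrix.IsSymm.smul (by rw [← sq]; exact (hH e).pow 2) _)
  have hW : ∀ x : E → X, 0 ≤ ∏ e, w e (x e) := fun x => Finset.prod_nonneg fun e _ => hw e _
  have h1 : ∑ x ∈ bad, (∏ e, w e (x e)) * Real.exp (t - ρ) ≤ Fintype.card ι := by
    refine le_trans ?_ (sum_prod_trace_exp_le hw hmgf hH hr)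
    refine le_trans (Finset.sum_le_sum fun x hx => mul_le_mul_of_nonneg_left ?_ (hW x))
      (Finset.sum_le_univ_sum_of_nonneg fun x => mul_nonneg (hW x) (trace_exp_nonneg (hsymm x)))
    obtain ⟨v, hv⟩ := hbad x hx
    refine exp_le_trace_exp (hsymm x) (v := v) ?_
    have h2 := hρ v
    have h3 : v ⬝ᵥ ((∑ e, (s e (x e) • H e - κ e • (H e * H e))).mulVec v)
        = v ⬝ᵥ ((∑ e, s e (x e) • H e).mulVec v) - ∑ e, κ e * (v ⬝ᵥ ((H e * H e).mulVec v)) := by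
      rw [Finset.sum_sub_distrib, Matrix.sub_mulVec, dotProduct_sub]
      congr 1
      rw [Matrix.sum_mulVec, dotProduct_sum]
      exact Finset.sum_congr rfl fun e _ => by rw [Matrix.smul_mulVec, dotProduct_smul, smul_eq_mul]
    rw [h3]
    linarith
  rw [← Finset.sum_mul] at h1
  rw [show ρ - t = -(t - ρ) by ring, Real.exp_neg]
  rwa [← div_eq_mul_inv, le_div_iff₀ (Real.exp_pos _)]

end TraceExp

section LazyChain

/-- Probability of the trajectory `y` under the lazy Bernoulli chain. -/
def chainProb (p α : ℝ) {N : ℕ} (y : Fin (N + 1) → Bool) : ℝ :=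
  bernProb p (y 0) * ∏ t : Fin N, lazyStep p α (y t.castSucc) (y t.succ)

/-- Number of time steps at which the trajectory `y` is `true`. -/
def trueCount {N : ℕ} (y : Fin N → Bool) : ℝ := ∑ t, if y t then 1 else 0

/-- Expectation of `f` over the next `N` steps of the lazy Bernoulli chain started at `b`. -/
def chainExp (p α : ℝ) {N : ℕ} (b : Bool) (f : (Fin N → Bool) → ℝ) : ℝ :=
  ∑ z : Fin N → Bool, (∏ t : Fin N, lazyStep p α ((Fin.cons b z : Fin (N + 1) → Bool) t.castSucc)
    (z t)) * f z

theorem chainExp_succ (p α : ℝ) {N : ℕ} (b : Bool) (f : (Fin (N + 1) → Bool) → ℝ) :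
    chainExp p α b f
      = ∑ b', lazyStep p α b b' * chainExp p α b' fun z => f (Fin.cons b' z) := by
  unfold chainExp
  rw [← (Fin.consEquiv fun _ => Bool).sum_comp, Fintype.sum_prod_type]
  refine Finset.sum_congr rfl fun b' _ => ?_
  rw [Finset.mul_sum]
  refine Finset.sum_congr rfl fun z _ => ?_
  have hc : (Fin.consEquiv fun _ => Bool) (b', z) = (Fin.cons b' z : Fin (N + 1) → Bool) := rfl
  simp only [hc, Fin.prod_univ_succ, Fin.castSucc_zero, Fin.cons_zero, Fin.castSucc_succ,
    Fin.cons_succ]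
  ring

theorem sum_chainProb_mul (p α : ℝ) {N : ℕ} (f : (Fin (N + 1) → Bool) → ℝ) :
    ∑ y, chainProb p α y * f y
      = ∑ b, bernProb p b * chainExp p α b fun z => f (Fin.cons b z) := by
  unfold chainExp chainProb
  rw [← (Fin.consEquiv fun _ => Bool).sum_comp, Fintype.sum_prod_type]
  refine Finset.sum_congr rfl fun b' _ => ?_
  rw [Finset.mul_sum]
  refine Finset.sum_congr rfl fun z _ => ?_
  have hc : (Fin.consEquiv fun _ => Bool) (b', z) = (Fin.cons b' z : Fin (N + 1) → Bool) := rfl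
  simp only [hc, Fin.cons_zero, Fin.cons_succ]
  ring

theorem trueCount_cons {N : ℕ} (b : Bool) (z : Fin N → Bool) :
    trueCount (Fin.cons b z : Fin (N + 1) → Bool) = (if b then 1 else 0) + trueCount z := by
  simp only [trueCount, Fin.sum_univ_succ, Fin.cons_zero, Fin.cons_succ]

theorem bernProb_nonneg {p : ℝ} (hp : p ∈ Set.Icc (0 : ℝ) 1) (b : Bool) : 0 ≤ bernProb p b := by
  cases b <;> simp [bernProb, hp.1, hp.2]

theorem lazyStep_nonneg {p α : ℝ} (hp : p ∈ Set.Icc (0 : ℝ) 1) (hα : α ∈ Set.Ioo (0 : ℝ) 1)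
    (b b' : Bool) : 0 ≤ lazyStep p α b b' := by
  have h1 := bernProb_nonneg hp b'
  have h2 : 0 ≤ 1 - α := by linarith [hα.2]
  have h3 := hα.1.le
  unfold lazyStep
  split_ifs <;> positivity

theorem chainProb_nonneg {p α : ℝ} (hp : p ∈ Set.Icc (0 : ℝ) 1) (hα : α ∈ Set.Ioo (0 : ℝ) 1)
    {N : ℕ} (y : Fin (N + 1) → Bool) : 0 ≤ chainProb p α y :=
  mul_nonneg (bernProb_nonneg hp _) (Finset.prod_nonneg fun _ _ => lazyStep_nonneg hp hα _ _)

theorem chainExp_const_mul (p α : ℝ) {N : ℕ} (b : Bool) (a : ℝ) (f : (Fin N → Bool) → ℝ) :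
    chainExp p α b (fun z => a * f z) = a * chainExp p α b f := by
  unfold chainExp
  rw [Finset.mul_sum]
  exact Finset.sum_congr rfl fun z _ => by ring

theorem chainExp_add (p α : ℝ) {N : ℕ} (b : Bool) (f g : (Fin N → Bool) → ℝ) :
    chainExp p α b (fun z => f z + g z) = chainExp p α b f + chainExp p α b g := by
  unfold chainExp
  rw [← Finset.sum_add_distrib]
  exact Finset.sum_congr rfl fun z _ => by ring

theorem chainExp_const (p α : ℝ) (N : ℕ) (b : Bool) (a : ℝ) :
    chainExp p α b (fun _ : Fin N → Bool => a) = a := by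
  induction N generalizing b with
  | zero => simp [chainExp]
  | succ N ih =>
    rw [chainExp_succ]
    simp only [ih]
    cases b <;> simp [lazyStep, bernProb] <;> ring

theorem exists_chainExp_trueCount_eq (p α : ℝ) (N : ℕ) :
    ∃ q : ℝ, ∀ b, chainExp p α b (fun z : Fin N → Bool => trueCount z)
      = N * p + ((if b then 1 else 0) - p) * q := by
  induction N with
  | zero => exact ⟨0, fun b => by simp [chainExp, trueCount]⟩
  | succ N ih =>
    obtain ⟨q, hq⟩ := ih
    refine ⟨α * (1 + q), fun b => ?_⟩
    rw [chainExp_succ]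
    simp only [trueCount_cons, chainExp_add, chainExp_const, hq]
    cases b <;> simp [lazyStep, bernProb] <;> ring

theorem sum_chainProb_mul_trueCount (p α : ℝ) (N : ℕ) :
    ∑ y : Fin (N + 1) → Bool, chainProb p α y * trueCount y = (N + 1) * p := by
  obtain ⟨q, hq⟩ := exists_chainExp_trueCount_eq p α N
  rw [sum_chainProb_mul]
  simp only [trueCount_cons, chainExp_add, chainExp_const, hq]
  simp [bernProb]
  ring

/-- Excess factor governing the growth of the moment generating function of the lazy chain. -/
def mgfExcess (α θ : ℝ) : ℕ → ℝ
  | 0 => Real.exp θ - 1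
  | k + 1 => Real.exp θ * (1 + α * mgfExcess α θ k) - 1

theorem one_add_mgfExcess_pos {α : ℝ} (hα : α ∈ Set.Ioo (0 : ℝ) 1) (θ : ℝ) (k : ℕ) :
    0 < 1 + mgfExcess α θ k := by
  induction k with
  | zero => simp [mgfExcess, Real.exp_pos]
  | succ k ih =>
    have : 0 < 1 + α * mgfExcess α θ k := by nlinarith [hα.1, hα.2]
    simp only [mgfExcess, add_sub_cancel]
    exact mul_pos (Real.exp_pos _) this

theorem chainExp_exp_trueCount_le {p α : ℝ} (hp : p ∈ Set.Icc (0 : ℝ) 1)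
    (hα : α ∈ Set.Ioo (0 : ℝ) 1) (θ : ℝ) (N : ℕ) :
    let c := ∏ i ∈ Finset.range N, (1 + (1 - α) * p * mgfExcess α θ i)
    chainExp p α false (fun z : Fin N → Bool => Real.exp (trueCount z * θ)) ≤ c ∧
    Real.exp θ * chainExp p α true (fun z : Fin N → Bool => Real.exp (trueCount z * θ))
      ≤ c * (1 + mgfExcess α θ N) := by
  have hf : ∀ i, 0 ≤ 1 + (1 - α) * p * mgfExcess α θ i := by
    intro i
    have h1 := one_add_mgfExcess_pos hα θ i
    have h2 : 0 ≤ (1 - α) * p := mul_nonneg (by linarith [hα.2]) hp.1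
    have h3 : (1 - α) * p ≤ 1 := by nlinarith [hα.1, hα.2, hp.1, hp.2]
    nlinarith
  induction N with
  | zero => simp [chainExp, trueCount, mgfExcess]
  | succ N ih =>
    obtain ⟨h0, h1⟩ := ih
    have hc0 : 0 ≤ ∏ i ∈ Finset.range N, (1 + (1 - α) * p * mgfExcess α θ i) :=
      Finset.prod_nonneg fun i _ => hf i
    simp only [Finset.prod_range_succ]
    set c := ∏ i ∈ Finset.range N, (1 + (1 - α) * p * mgfExcess α θ i) with hc
    set F0 := chainExp p α false (fun z : Fin N → Bool => Real.exp (trueCount z * θ)) with hF0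
    set F1 := chainExp p α true (fun z : Fin N → Bool => Real.exp (trueCount z * θ)) with hF1
    set y := mgfExcess α θ N with hy
    have hα0 := hα.1
    have hγ : 0 < 1 - α := by linarith [hα.2]
    have hp0 := hp.1
    have hp1 : 0 ≤ 1 - p := by linarith [hp.2]
    have e0 : chainExp p α false (fun z : Fin (N + 1) → Bool => Real.exp (trueCount z * θ))
        = (α + (1 - α) * (1 - p)) * F0 + (1 - α) * p * (Real.exp θ * F1) := by
      rw [chainExp_succ]
      simp [trueCount_cons, add_mul, Real.exp_add, chainExp_const_mul, lazyStep, bernProb]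
      ring
    have e1 : chainExp p α true (fun z : Fin (N + 1) → Bool => Real.exp (trueCount z * θ))
        = (1 - α) * (1 - p) * F0 + (α + (1 - α) * p) * (Real.exp θ * F1) := by
      rw [chainExp_succ]
      simp [trueCount_cons, add_mul, Real.exp_add, chainExp_const_mul, lazyStep, bernProb]
      ring
    rw [e0, e1]
    constructor
    · calc (α + (1 - α) * (1 - p)) * F0 + (1 - α) * p * (Real.exp θ * F1)
          ≤ (α + (1 - α) * (1 - p)) * c + (1 - α) * p * (c * (1 + y)) := by gcongr
        _ = c * (1 + (1 - α) * p * y) := by ring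
    · have h2 : (1 - α) * (1 - p) * F0 + (α + (1 - α) * p) * (Real.exp θ * F1)
          ≤ c * (1 + (1 - α) * p * y) * (1 + α * y) := by
        calc (1 - α) * (1 - p) * F0 + (α + (1 - α) * p) * (Real.exp θ * F1)
            ≤ (1 - α) * (1 - p) * c + (α + (1 - α) * p) * (c * (1 + y)) := by gcongr
          _ = c * (1 + α * y + (1 - α) * p * y) := by ring
          _ ≤ c * ((1 + (1 - α) * p * y) * (1 + α * y)) := by
            gcongr
            have : 0 ≤ (1 - α) * p * α * (y * y) :=
              mul_nonneg (mul_nonneg (mul_nonneg hγ.le hp0) hα0.le) (mul_self_nonneg y)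
            nlinarith
          _ = _ := by ring
      have e3 : 1 + mgfExcess α θ (N + 1) = Real.exp θ * (1 + α * y) := by
        simp [mgfExcess, hy]
      rw [e3]
      calc _ ≤ Real.exp θ * (c * (1 + (1 - α) * p * y) * (1 + α * y)) := by gcongr
        _ = _ := by ring

theorem geom_sum_le_inv {α : ℝ} (hα : α ∈ Set.Ioo (0 : ℝ) 1) (k : ℕ) :
    ∑ i ∈ Finset.range k, α ^ i ≤ 1 / (1 - α) := by
  have hγ : 0 < 1 - α := by linarith [hα.2]
  have h := geom_sum_mul_neg α k
  rw [le_div_iff₀ hγ, h]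
  have := pow_nonneg hα.1.le k
  linarith

theorem mgfExcess_le {α θ : ℝ} (hα : α ∈ Set.Ioo (0 : ℝ) 1) (hθ : |θ| ≤ (1 - α) / 4) (k : ℕ) :
    mgfExcess α θ k
      ≤ θ * ∑ i ∈ Finset.range (k + 1), α ^ i + 6 / (1 - α) ^ 2 * θ ^ 2 := by
  have hα0 := hα.1
  have hγ : 0 < 1 - α := by linarith [hα.2]
  have hγ1 : 1 - α < 1 := by linarith
  have hθ1 : |θ| ≤ 1 / 4 := by linarith
  have hexp : Real.exp θ ≤ 1 + θ + θ ^ 2 := by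
    have := Real.abs_exp_sub_one_sub_id_le (x := θ) (by linarith)
    linarith [(abs_le.1 this).2]
  set K : ℝ := 6 / (1 - α) ^ 2 with hK
  set g : ℝ := 1 / (1 - α) with hg
  have hgK : (1 - α) * K = 6 * g := by rw [hK, hg]; field_simp
  have hg1 : 1 ≤ g := by rw [hg, le_div_iff₀ hγ]; linarith
  have hK0 : 0 ≤ K := by positivity
  induction k with
  | zero =>
    simp only [mgfExcess, zero_add, Finset.range_one, Finset.sum_singleton, pow_zero, mul_one]
    have : 1 ≤ K := by nlinarith
    nlinarith [sq_nonneg θ]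
  | succ k ih =>
    have hs := geom_sum_le_inv hα (k + 1)
    have hs0 : 0 ≤ ∑ i ∈ Finset.range (k + 1), α ^ i := Finset.sum_nonneg fun i _ => by positivity
    have hsum : ∑ i ∈ Finset.range (k + 1 + 1), α ^ i
        = 1 + α * ∑ i ∈ Finset.range (k + 1), α ^ i := by
      rw [Finset.sum_range_succ', Finset.mul_sum, pow_zero, add_comm]
      simp only [pow_succ']
    rw [hsum]
    set s := ∑ i ∈ Finset.range (k + 1), α ^ i with hsdef
    have hpos : 0 < 1 + α * mgfExcess α θ k := by
      nlinarith [one_add_mgfExcess_pos hα θ k]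
    have hY : 1 + α * mgfExcess α θ k ≤ 1 + α * (θ * s + K * θ ^ 2) := by gcongr
    have h1 : Real.exp θ * (1 + α * mgfExcess α θ k)
        ≤ (1 + θ + θ ^ 2) * (1 + α * (θ * s + K * θ ^ 2)) := by
      have h0 : 0 ≤ 1 + θ + θ ^ 2 := (Real.exp_pos θ).le.trans hexp
      exact mul_le_mul hexp hY hpos.le h0
    have hb := abs_le.1 hθ
    have hb1 := abs_le.1 hθ1
    have hb2 : θ + θ ^ 2 ≤ 5 / 16 * (1 - α) := by nlinarith
    have hA : α * s * (1 + θ) ≤ 5 / 4 * g := by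
      have : α * s ≤ g := by nlinarith
      have : 0 ≤ α * s := by positivity
      nlinarith
    have hB : α * K * (θ + θ ^ 2) ≤ 30 / 16 * g := by
      have h2 : α * K * (θ + θ ^ 2) ≤ α * K * (5 / 16 * (1 - α)) := by gcongr
      have h3 : α * K * (5 / 16 * (1 - α)) = α * (30 / 16 * g) := by
        linear_combination (5 / 16 * α) * hgK
      nlinarith
    have hbr : α * K + α * s + 1 - K + α * K * θ + α * s * θ + α * K * θ ^ 2 ≤ 0 := by
      nlinarith
    have hfin : (1 + θ + θ ^ 2) * (1 + α * (θ * s + K * θ ^ 2)) - 1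
        = θ * (1 + α * s) + K * θ ^ 2
          + θ ^ 2 * (α * K + α * s + 1 - K + α * K * θ + α * s * θ + α * K * θ ^ 2) := by ring
    have hneg := mul_nonpos_of_nonneg_of_nonpos (sq_nonneg θ) hbr
    simp only [mgfExcess]
    linarith

theorem sum_chainProb_mul_exp_le {p α θ : ℝ} (hp : p ∈ Set.Icc (0 : ℝ) 1)
    (hα : α ∈ Set.Ioo (0 : ℝ) 1) (hθ : |θ| ≤ (1 - α) / 4) (N : ℕ) :
    ∑ y : Fin (N + 1) → Bool, chainProb p α y * Real.exp (trueCount y * θ)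
      ≤ Real.exp ((N + 1) * p * θ + 6 / (1 - α) ^ 2 * ((N + 1) * p) * θ ^ 2) := by
  have hγ : 0 < 1 - α := by linarith [hα.2]
  have hγ1 : 1 - α ≤ 1 := by linarith [hα.1]
  have hp0 := hp.1
  have hp1 : 0 ≤ 1 - p := by linarith [hp.2]
  set K : ℝ := 6 / (1 - α) ^ 2 with hK
  have hK0 : 0 ≤ K := by positivity
  obtain ⟨h0, h1⟩ := chainExp_exp_trueCount_le hp hα θ N
  set c := ∏ i ∈ Finset.range N, (1 + (1 - α) * p * mgfExcess α θ i) with hc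
  have hcle : c ≤ Real.exp (∑ i ∈ Finset.range N, (1 - α) * p * mgfExcess α θ i) := by
    rw [Real.exp_sum, hc]
    refine Finset.prod_le_prod (fun i _ => ?_) fun i _ => ?_
    · have h1 := one_add_mgfExcess_pos hα θ i
      have h2 : 0 ≤ (1 - α) * p := mul_nonneg hγ.le hp0
      have h3 : (1 - α) * p ≤ 1 := by nlinarith [hα.1, hp.2]
      nlinarith
    · linarith [Real.add_one_le_exp ((1 - α) * p * mgfExcess α θ i)]
  have htel : ∀ M : ℕ, (1 - α) * ∑ j ∈ Finset.range M, ∑ i ∈ Finset.range (j + 1), α ^ i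
      + ∑ i ∈ Finset.range (M + 1), α ^ i = M + 1 := by
    intro M
    induction M with
    | zero => simp
    | succ M ih =>
      have hsum : ∑ i ∈ Finset.range (M + 1 + 1), α ^ i
          = 1 + α * ∑ i ∈ Finset.range (M + 1), α ^ i := by
        rw [Finset.sum_range_succ', Finset.mul_sum, pow_zero, add_comm]
        simp only [pow_succ']
      rw [hsum, Finset.sum_range_succ]
      push_cast
      linarith
  have hlog : ∑ i ∈ Finset.range N, (1 - α) * p * mgfExcess α θ i + p * mgfExcess α θ N
      ≤ (N + 1) * p * θ + K * ((N + 1) * p) * θ ^ 2 := by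
    have h2 : ∑ i ∈ Finset.range N, (1 - α) * p * mgfExcess α θ i
        ≤ ∑ i ∈ Finset.range N, (1 - α) * p *
          (θ * ∑ j ∈ Finset.range (i + 1), α ^ j + K * θ ^ 2) :=
      Finset.sum_le_sum fun i _ => by
        have := mgfExcess_le hα hθ i
        gcongr
    have h3 : p * mgfExcess α θ N
        ≤ p * (θ * ∑ j ∈ Finset.range (N + 1), α ^ j + K * θ ^ 2) := by
      have := mgfExcess_le hα hθ N
      gcongr
    have h4 : ∑ i ∈ Finset.range N, (1 - α) * p *
          (θ * ∑ j ∈ Finset.range (i + 1), α ^ j + K * θ ^ 2)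
        = p * θ * ((1 - α) * ∑ i ∈ Finset.range N, ∑ j ∈ Finset.range (i + 1), α ^ j)
          + (1 - α) * p * K * θ ^ 2 * N := by
      simp only [mul_add, Finset.sum_add_distrib, Finset.sum_const, Finset.card_range,
        nsmul_eq_mul, Finset.mul_sum]
      congr 1
      · exact Finset.sum_congr rfl fun i _ => Finset.sum_congr rfl fun j _ => by ring
      · ring
    have h5 : (1 - α) * p * K * θ ^ 2 * N ≤ p * K * θ ^ 2 * N := by
      have : 0 ≤ p * K * θ ^ 2 * N := by positivity
      nlinarith
    have h6 : p * θ * ((1 - α) * ∑ j ∈ Finset.range N, ∑ i ∈ Finset.range (j + 1), α ^ i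
        + ∑ i ∈ Finset.range (N + 1), α ^ i) = p * θ * (N + 1) := by rw [htel N]
    nlinarith
  have htot : ∑ y : Fin (N + 1) → Bool, chainProb p α y * Real.exp (trueCount y * θ)
      = p * (Real.exp θ * chainExp p α true (fun z : Fin N → Bool => Real.exp (trueCount z * θ)))
        + (1 - p) * chainExp p α false (fun z : Fin N → Bool => Real.exp (trueCount z * θ)) := by
    rw [sum_chainProb_mul]
    simp [trueCount_cons, add_mul, Real.exp_add, chainExp_const_mul, bernProb]
  rw [htot]
  calc _ ≤ p * (c * (1 + mgfExcess α θ N)) + (1 - p) * c := by gcongr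
    _ = c * (1 + p * mgfExcess α θ N) := by ring
    _ ≤ Real.exp (∑ i ∈ Finset.range N, (1 - α) * p * mgfExcess α θ i)
        * Real.exp (p * mgfExcess α θ N) := by
      refine mul_le_mul hcle ?_ ?_ (Real.exp_pos _).le
      · linarith [Real.add_one_le_exp (p * mgfExcess α θ N)]
      · nlinarith [one_add_mgfExcess_pos hα θ N, hp.2]
    _ ≤ _ := by
      rw [← Real.exp_add]
      exact Real.exp_le_exp.2 hlog

theorem sum_chainProb_mul_exp_centered_le {p α l : ℝ} (hp : p ∈ Set.Icc (0 : ℝ) 1)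
    (hα : α ∈ Set.Ioo (0 : ℝ) 1) (hl : |l| ≤ (1 - α) / 4) (N : ℕ) :
    ∑ y : Fin (N + 1) → Bool, chainProb p α y *
      Real.exp ((trueCount y - (N + 1) * p) * l - 6 / (1 - α) ^ 2 * ((N + 1) * p) * l ^ 2) ≤ 1 := by
  have h := sum_chainProb_mul_exp_le hp hα hl N
  set B := (N + 1) * p * l + 6 / (1 - α) ^ 2 * ((N + 1) * p) * l ^ 2 with hB
  have e : ∀ y : Fin (N + 1) → Bool, chainProb p α y *
      Real.exp ((trueCount y - (N + 1) * p) * l - 6 / (1 - α) ^ 2 * ((N + 1) * p) * l ^ 2)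
      = chainProb p α y * Real.exp (trueCount y * l) * Real.exp (-B) := by
    intro y
    rw [mul_assoc (chainProb p α y), ← Real.exp_add, hB]
    congr 2
    ring
  rw [Finset.sum_congr rfl fun y _ => e y, ← Finset.sum_mul]
  calc _ ≤ Real.exp B * Real.exp (-B) := by gcongr
    _ = 1 := by rw [← Real.exp_add]; simp

end LazyChain

section NormalizedMatrix

open scoped Matrix.Norms.L2Operator

variable {ι : Type*}

/-- The matrix `D^{-1/2} a D^{-1/2}` with `D` the diagonal matrix with entries `d`. -/
def normalizedMatrix (a : ι → ι → ℝ) (d : ι → ℝ) : Matrix ι ι ℝ :=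
  Matrix.of fun k l => a k l / (Real.sqrt (d k) * Real.sqrt (d l))

theorem normalizedMatrix_isSymm {a : ι → ι → ℝ} (hs : ∀ k l, a k l = a l k) (d : ι → ℝ) :
    (normalizedMatrix a d).IsSymm :=
  Matrix.IsSymm.ext fun k l => by simp only [normalizedMatrix, Matrix.of_apply]; rw [hs, mul_comm]

variable [Fintype ι]

theorem dotProduct_normalizedMatrix_mulVec (a : ι → ι → ℝ) (d : ι → ℝ) (v : ι → ℝ) :
    v ⬝ᵥ (normalizedMatrix a d).mulVec v
      = ∑ k, ∑ l, a k l * (v k / Real.sqrt (d k)) * (v l / Real.sqrt (d l)) := by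
  simp only [dotProduct, Matrix.mulVec, normalizedMatrix, Matrix.of_apply, Finset.mul_sum]
  refine Finset.sum_congr rfl fun k _ => Finset.sum_congr rfl fun l _ => ?_
  simp only [div_eq_mul_inv, mul_inv]
  ring

theorem abs_sum_mul_mul_le {a : ι → ι → ℝ} (hs : ∀ k l, a k l = a l k) (ha : ∀ k l, 0 ≤ a k l)
    (u : ι → ℝ) : |∑ k, ∑ l, a k l * u k * u l| ≤ ∑ k, (∑ l, a k l) * u k ^ 2 := by
  have h1 : |∑ k, ∑ l, a k l * u k * u l| ≤ ∑ k, ∑ l, a k l * ((u k ^ 2 + u l ^ 2) / 2) := by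
    refine (Finset.abs_sum_le_sum_abs _ _).trans (Finset.sum_le_sum fun k _ => ?_)
    refine (Finset.abs_sum_le_sum_abs _ _).trans (Finset.sum_le_sum fun l _ => ?_)
    rw [mul_assoc, abs_mul, abs_of_nonneg (ha k l)]
    refine mul_le_mul_of_nonneg_left (abs_le.2 ⟨?_, ?_⟩) (ha k l)
    · nlinarith [sq_nonneg (u k + u l)]
    · nlinarith [sq_nonneg (u k - u l)]
  refine h1.trans_eq ?_
  have h2 : ∑ k, ∑ l, a k l * u l ^ 2 = ∑ k, ∑ l, a k l * u k ^ 2 := by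
    rw [Finset.sum_comm]
    exact Finset.sum_congr rfl fun k _ => Finset.sum_congr rfl fun l _ => by rw [hs]
  have h3 : ∑ k, ∑ l, a k l * ((u k ^ 2 + u l ^ 2) / 2)
      = (∑ k, ∑ l, a k l * u k ^ 2 + ∑ k, ∑ l, a k l * u l ^ 2) / 2 := by
    rw [← Finset.sum_add_distrib, Finset.sum_div]
    refine Finset.sum_congr rfl fun k _ => ?_
    rw [← Finset.sum_add_distrib, Finset.sum_div]
    exact Finset.sum_congr rfl fun l _ => by ring
  rw [h3, h2, add_self_div_two]
  simp only [Finset.sum_mul]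

variable [DecidableEq ι]

theorem opNorm_eq_norm {n : ℕ} (M : Matrix (Fin n) (Fin n) ℝ) : opNorm M = ‖M‖ := rfl

theorem Matrix.IsSymm.norm_le_of_quadratic_form_le {M : Matrix ι ι ℝ} (hM : M.IsSymm) {r : ℝ}
    (hr : 0 ≤ r) (h : ∀ v, |v ⬝ᵥ M.mulVec v| ≤ r * (v ⬝ᵥ v)) : ‖M‖ ≤ r := by
  have hsymm : ∀ x y, y ⬝ᵥ M.mulVec x = x ⬝ᵥ M.mulVec y := by
    intro x y
    rw [Matrix.dotProduct_mulVec, ← Matrix.mulVec_transpose, hM.eq, dotProduct_comm]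
  have hpol : ∀ x y, x ⬝ᵥ M.mulVec y ≤ r * ((x ⬝ᵥ x) + (y ⬝ᵥ y)) / 2 := by
    intro x y
    have h1 := (abs_le.1 (h (x + y))).2
    have h2 := (abs_le.1 (h (x - y))).1
    simp only [Matrix.mulVec_add, Matrix.mulVec_sub, dotProduct_add, add_dotProduct,
      dotProduct_sub, sub_dotProduct, hsymm x y, dotProduct_comm y x] at h1 h2
    linarith
  rw [Matrix.l2_opNorm_def]
  refine ContinuousLinearMap.opNorm_le_bound _ hr fun x => ?_
  set y : ι → ℝ := M.mulVec x.ofLp with hy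
  have hx2 : ‖x‖ ^ 2 = x.ofLp ⬝ᵥ x.ofLp := by
    rw [EuclideanSpace.real_norm_sq_eq]; simp [dotProduct, sq]
  have hy2 : ‖WithLp.toLp 2 y‖ ^ 2 = y ⬝ᵥ y := by
    rw [EuclideanSpace.real_norm_sq_eq]; simp [dotProduct, sq]
  change ‖WithLp.toLp 2 y‖ ≤ r * ‖x‖
  set a := ‖x‖ with ha
  set b := ‖WithLp.toLp 2 y‖ with hb
  have ha0 : 0 ≤ a := norm_nonneg _
  have hb0 : 0 ≤ b := norm_nonneg _
  have key := hpol (b • x.ofLp) (a • y)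
  simp only [Matrix.mulVec_smul, dotProduct_smul, smul_dotProduct, smul_eq_mul,
    ← hx2, ← hy2, ← hsymm x.ofLp y] at key
  rw [← hy, ← hy2] at key
  rcases hb0.eq_or_lt with h0 | h0
  · rw [← h0]; positivity
  rcases ha0.eq_or_lt with h0' | h0'
  · have : x = 0 := norm_eq_zero.1 h0'.symm
    have hyz : y = 0 := by rw [hy, this]; simp
    rw [hb, hyz]; simp; positivity
  · have : a * b ^ 2 * b ≤ a * b ^ 2 * (r * a) := by nlinarith
    exact le_of_mul_le_mul_left this (by positivity)

theorem norm_normalizedMatrix_le_one {a : ι → ι → ℝ} (hs : ∀ k l, a k l = a l k)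
    (ha : ∀ k l, 0 ≤ a k l) : ‖normalizedMatrix a fun k => ∑ l, a k l‖ ≤ 1 := by
  refine (normalizedMatrix_isSymm hs _).norm_le_of_quadratic_form_le zero_le_one fun v => ?_
  rw [dotProduct_normalizedMatrix_mulVec]
  refine (abs_sum_mul_mul_le hs ha _).trans ?_
  rw [one_mul, dotProduct]
  refine Finset.sum_le_sum fun k _ => ?_
  have hd : 0 ≤ ∑ l, a k l := Finset.sum_nonneg fun l _ => ha k l
  rw [div_pow, Real.sq_sqrt hd, ← sq]
  rcases hd.eq_or_lt with h | h
  · rw [← h]; simp [sq_nonneg]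
  · rw [mul_div_cancel₀ _ h.ne']

theorem norm_normalizedMatrix_sub_le {a b : ι → ι → ℝ} (hsa : ∀ k l, a k l = a l k)
    (hsb : ∀ k l, b k l = b l k) (ha : ∀ k l, 0 ≤ a k l) (hb : ∀ k l, 0 ≤ b k l)
    (hb0 : ∀ k, 0 < ∑ l, b k l) {t : ℝ} (ht : 0 ≤ t)
    (hadj : ∀ v, |v ⬝ᵥ (normalizedMatrix (fun k l => a k l - b k l)
      fun k => ∑ l, b k l).mulVec v| ≤ t * (v ⬝ᵥ v))
    (hdeg : ∀ k, |∑ l, a k l - ∑ l, b k l| ≤ t * ∑ l, b k l) :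
    ‖(normalizedMatrix a fun k => ∑ l, a k l) - normalizedMatrix b fun k => ∑ l, b k l‖
      ≤ 4 * t := by
  set d : ι → ℝ := fun k => ∑ l, a k l with hd
  set e : ι → ℝ := fun k => ∑ l, b k l with he
  have hN := norm_normalizedMatrix_le_one hsa ha
  have hN' := norm_normalizedMatrix_le_one hsb hb
  rw [← hd] at hN
  rw [← he] at hN'
  set N := normalizedMatrix a d with hNdef
  set N' := normalizedMatrix b e with hN'def
  rcases le_or_gt t 1 with h1 | h1
  swap
  · linarith [norm_sub_le N N']
  have hd0 : ∀ k, 0 ≤ d k := fun k => Finset.sum_nonneg fun l _ => ha k l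
  set G : Matrix ι ι ℝ := Matrix.diagonal fun k => Real.sqrt (d k / e k) with hG
  have hg : ∀ k, |Real.sqrt (d k / e k) - 1| ≤ t := by
    intro k
    have hsq := Real.sq_sqrt (div_nonneg (hd0 k) (hb0 k).le)
    have hs0 := Real.sqrt_nonneg (d k / e k)
    have h2 : |d k / e k - 1| ≤ t := by
      have : d k / e k - 1 = (d k - e k) / e k := by
        rw [sub_div, div_self (hb0 k).ne']
      rw [this, abs_div, abs_of_pos (hb0 k), div_le_iff₀ (hb0 k)]
      exact hdeg k
    set s := Real.sqrt (d k / e k)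
    have h3 : d k / e k - 1 = (s - 1) * (s + 1) := by linear_combination -hsq
    rw [h3, abs_mul, abs_of_nonneg (by linarith : 0 ≤ s + 1)] at h2
    nlinarith [abs_nonneg (s - 1)]
  have hG1 : ‖G - 1‖ ≤ t := by
    rw [hG, ← Matrix.diagonal_one, Matrix.diagonal_sub, Matrix.l2_opNorm_diagonal]
    exact (pi_norm_le_iff_of_nonneg ht).2 hg
  have hG2 : ‖G‖ ≤ 1 + t := by
    rw [hG, Matrix.l2_opNorm_diagonal]
    refine (pi_norm_le_iff_of_nonneg (by linarith)).2 fun k => ?_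
    rw [Real.norm_eq_abs, abs_of_nonneg (Real.sqrt_nonneg _)]
    linarith [(abs_le.1 (hg k)).2]
  have hS : ‖normalizedMatrix (fun k l => a k l - b k l) e‖ ≤ t :=
    (normalizedMatrix_isSymm (fun k l => by rw [hsa, hsb]) _).norm_le_of_quadratic_form_le ht hadj
  have hQ : G * N * G = normalizedMatrix a e := by
    ext k l
    simp only [hG, hNdef, Matrix.mul_diagonal, Matrix.diagonal_mul, normalizedMatrix,
      Matrix.of_apply]
    have hak : ∀ k l, d k = 0 → a k l = 0 := fun k l h =>
      (Finset.sum_eq_zero_iff_of_nonneg fun l _ => ha k l).1 h l (Finset.mem_univ _)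
    by_cases hk : d k = 0
    · simp [hak k l hk]
    by_cases hl : d l = 0
    · simp [hsa k l, hak l k hl]
    have hk' := Real.sqrt_ne_zero'.2 ((hd0 k).lt_of_ne' hk)
    have hl' := Real.sqrt_ne_zero'.2 ((hd0 l).lt_of_ne' hl)
    have hek := Real.sqrt_ne_zero'.2 (hb0 k)
    have hel := Real.sqrt_ne_zero'.2 (hb0 l)
    rw [Real.sqrt_div (hd0 k), Real.sqrt_div (hd0 l)]
    change Real.sqrt (e k) ≠ 0 at hek
    change Real.sqrt (e l) ≠ 0 at hel
    field_simp
  have hsub : normalizedMatrix (fun k l => a k l - b k l) e = G * N * G - N' := by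
    rw [hQ]
    ext k l
    simp only [hN'def, normalizedMatrix, Matrix.of_apply, Matrix.sub_apply, sub_div]
  have hdec : N - N' = normalizedMatrix (fun k l => a k l - b k l) e
      - ((G - 1) * N * G + N * (G - 1)) := by
    rw [hsub]
    noncomm_ring
  rw [hdec]
  have h4 : ‖(G - 1) * N * G‖ ≤ t * 1 * (1 + t) := by
    refine (norm_mul_le _ _).trans ?_
    refine mul_le_mul ((norm_mul_le _ _).trans ?_) hG2 (norm_nonneg _) (by linarith)
    exact mul_le_mul hG1 hN (norm_nonneg _) ht
  have h5 : ‖N * (G - 1)‖ ≤ 1 * t :=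
    (norm_mul_le _ _).trans (mul_le_mul hN hG1 (norm_nonneg _) zero_le_one)
  have h6 := norm_sub_le (normalizedMatrix (fun k l => a k l - b k l) e)
    ((G - 1) * N * G + N * (G - 1))
  have h7 := norm_add_le ((G - 1) * N * G) (N * (G - 1))
  nlinarith

end NormalizedMatrix

section EdgeConcentration

variable {ι : Type*} [Fintype ι] [DecidableEq ι]

theorem sum_prod_filter_abs_le {E X : Type*} [Fintype E] [DecidableEq E] [Fintype X]
    {w s : E → X → ℝ} (hw : ∀ e x, 0 ≤ w e x) {q : E → ℝ} {K t m : ℝ} (hK : 0 < K)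
    (ht : 0 < t) (hm : 0 < m)
    (hmgf : ∀ e, ∀ l : ℝ, |l| ≤ t / (2 * K) →
      ∑ x, w e x * Real.exp (s e x * l - K * q e * l ^ 2) ≤ 1)
    {H : E → Matrix ι ι ℝ} (hH : ∀ e, (H e).IsSymm)
    (hr : ∀ e v, |v ⬝ᵥ ((H e).mulVec v)| ≤ 1 / m * (v ⬝ᵥ v))
    (hρ : ∀ v, ∑ e, q e * (v ⬝ᵥ ((H e * H e).mulVec v)) ≤ 1 / m * (v ⬝ᵥ v))
    {bad : Finset (E → X)}
    (hbad : ∀ x ∈ bad, ∃ v, t * (v ⬝ᵥ v) < |v ⬝ᵥ ((∑ e, s e (x e) • H e).mulVec v)|) :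
    ∑ x ∈ bad, ∏ e, w e (x e)
      ≤ 2 * (Fintype.card ι * Real.exp (-(t ^ 2 * m / (4 * K)))) := by
  classical
  have hone : ∀ σ : ℝ, σ ^ 2 = 1 → ∑ x ∈ bad with
      ∃ v, t * (v ⬝ᵥ v) < σ * (v ⬝ᵥ ((∑ e, s e (x e) • H e).mulVec v)), ∏ e, w e (x e)
      ≤ Fintype.card ι * Real.exp (-(t ^ 2 * m / (4 * K))) := by
    intro σ hσ
    have hσ' : |σ| = 1 := by
      rcases sq_eq_one_iff.1 hσ with h | h <;> simp [h]
    have hθ : 0 < t * m / (2 * K) := by positivity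
    set θ := t * m / (2 * K) with hθdef
    have hexp : -(t ^ 2 * m / (4 * K)) = K * θ ^ 2 / m - θ * t := by
      rw [hθdef]; field_simp; ring
    rw [hexp]
    refine sum_prod_filter_le (H := fun e => (σ * θ) • H e) (κ := fun e => K * q e) hw hmgf
      (fun e => (hH e).smul _) (fun e v => ?_) (fun v => ?_) (fun x hx => ?_)
    · rw [Matrix.smul_mulVec, dotProduct_smul, smul_eq_mul, abs_mul, abs_mul, hσ', one_mul,
        abs_of_pos hθ]
      refine (mul_le_mul_of_nonneg_left (hr e v) hθ.le).trans_eq ?_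
      rw [hθdef]; field_simp
    · have : ∀ e, K * q e * (v ⬝ᵥ (((σ * θ) • H e * (σ * θ) • H e).mulVec v))
          = K * θ ^ 2 * (q e * (v ⬝ᵥ ((H e * H e).mulVec v))) := by
        intro e
        rw [Matrix.smul_mul, Matrix.mul_smul, Matrix.smul_mulVec, Matrix.smul_mulVec,
          dotProduct_smul, dotProduct_smul, smul_eq_mul, smul_eq_mul]
        linear_combination (K * q e * θ ^ 2 * (v ⬝ᵥ ((H e * H e).mulVec v))) * hσ
      rw [Finset.sum_congr rfl fun e _ => this e, ← Finset.mul_sum]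
      refine (mul_le_mul_of_nonneg_left (hρ v) (by positivity)).trans_eq ?_
      field_simp
    · obtain ⟨v, hv⟩ := (Finset.mem_filter.1 hx).2
      refine ⟨v, ?_⟩
      have : ∑ e, s e (x e) • (σ * θ) • H e = (σ * θ) • ∑ e, s e (x e) • H e := by
        rw [Finset.smul_sum]
        exact Finset.sum_congr rfl fun e _ => smul_comm _ _ _
      rw [this, Matrix.smul_mulVec, dotProduct_smul, smul_eq_mul]
      nlinarith
  have hp := hone 1 (by norm_num)
  have hn := hone (-1) (by norm_num)
  have hW : ∀ x : E → X, 0 ≤ ∏ e, w e (x e) := fun x => Finset.prod_nonneg fun e _ => hw e _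
  refine le_trans ?_ ((add_le_add hp hn).trans_eq (two_mul _).symm)
  rw [← Finset.sum_union_inter]
  refine le_trans ?_ (le_add_of_nonneg_right (Finset.sum_nonneg fun x _ => hW x))
  refine Finset.sum_le_sum_of_subset_of_nonneg (fun x hx => ?_) fun x _ _ => hW x
  obtain ⟨v, hv⟩ := hbad x hx
  rw [Finset.mem_union, Finset.mem_filter, Finset.mem_filter]
  rcases lt_abs.1 hv with h | h
  · exact Or.inl ⟨hx, v, by simpa using h⟩
  · exact Or.inr ⟨hx, v, by simpa using h⟩

variable {E : Type*} [Fintype E] [DecidableEq E] {edge : ι → ι → E}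

omit [DecidableEq ι] [Fintype E] in
theorem sum_ite_edge_le_one (hinj : ∀ k l l', edge k l = edge k l' → l = l') (e : E) (k : ι) :
    ∑ l, (if edge k l = e then (1 : ℝ) else 0) ≤ 1 := by
  rw [Finset.sum_boole]
  have h : (Finset.univ.filter fun l => edge k l = e).card ≤ 1 :=
    Finset.card_le_one.2 fun a ha b hb =>
      hinj k a b ((Finset.mem_filter.1 ha).2.trans (Finset.mem_filter.1 hb).2.symm)
  exact_mod_cast h

omit [DecidableEq ι] [Fintype E] in
theorem sq_sum_ite_edge_mul_le (hinj : ∀ k l l', edge k l = edge k l' → l = l') (e : E) (k : ι)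
    (c : ι → ℝ) : (∑ l, (if edge k l = e then (1 : ℝ) else 0) * c l) ^ 2
      ≤ ∑ l, (if edge k l = e then (1 : ℝ) else 0) * c l ^ 2 := by
  have h := Finset.sum_mul_sq_le_sq_mul_sq Finset.univ
    (fun l => if edge k l = e then (1 : ℝ) else 0)
    (fun l => (if edge k l = e then (1 : ℝ) else 0) * c l)
  have h1 := sum_ite_edge_le_one hinj e k
  have h2 : 0 ≤ ∑ l, (if edge k l = e then (1 : ℝ) else 0) * c l ^ 2 :=
    Finset.sum_nonneg fun l _ => by split_ifs <;> simp [sq_nonneg]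
  simp only [ite_mul, one_mul, zero_mul, ite_pow, one_pow, ne_eq, OfNat.ofNat_ne_zero,
    not_false_eq_true, zero_pow] at h h2 ⊢
  have h3 : ∀ l, (if edge k l = e then (if edge k l = e then c l else 0) else 0)
      = if edge k l = e then c l else 0 := fun l => by split_ifs <;> rfl
  simp only [h3] at h
  nlinarith

omit [DecidableEq ι] in
theorem sum_mul_sum_ite_edge (f : E → ℝ) (g : ι → ℝ) (k : ι) :
    ∑ e, f e * ∑ l, (if edge k l = e then (1 : ℝ) else 0) * g l = ∑ l, f (edge k l) * g l := by
  simp only [Finset.mul_sum]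
  rw [Finset.sum_comm]
  refine Finset.sum_congr rfl fun l _ => ?_
  simp

omit [DecidableEq ι] in
theorem dotProduct_mul_self_mulVec {M : Matrix ι ι ℝ} (hM : M.IsSymm) (v : ι → ℝ) :
    v ⬝ᵥ ((M * M).mulVec v) = ∑ k, (M.mulVec v k) ^ 2 := by
  rw [← Matrix.mulVec_mulVec, Matrix.dotProduct_mulVec, ← Matrix.mulVec_transpose, hM.eq]
  simp [dotProduct, sq]

variable {q : E → ℝ} {m : ℝ}

omit [DecidableEq ι] [Fintype E] in
theorem abs_dotProduct_edgeAdj_le (hsym : ∀ k l, edge k l = edge l k)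
    (hinj : ∀ k l l', edge k l = edge k l' → l = l') {d : ι → ℝ} (hm : 0 < m)
    (hd : ∀ k, m ≤ d k) (e : E) (v : ι → ℝ) :
    |v ⬝ᵥ (normalizedMatrix (fun k l => if edge k l = e then (1 : ℝ) else 0) d).mulVec v|
      ≤ 1 / m * (v ⬝ᵥ v) := by
  rw [dotProduct_normalizedMatrix_mulVec]
  refine (abs_sum_mul_mul_le (fun k l => by rw [hsym]) (fun k l => by positivity) _).trans ?_
  rw [dotProduct, Finset.mul_sum]
  refine Finset.sum_le_sum fun k _ => ?_
  have hdk : 0 < d k := hm.trans_le (hd k)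
  rw [div_pow, Real.sq_sqrt hdk.le, ← sq]
  calc _ ≤ 1 * (v k ^ 2 / d k) :=
        mul_le_mul_of_nonneg_right (sum_ite_edge_le_one hinj e k) (by positivity)
    _ = 1 / d k * v k ^ 2 := by ring
    _ ≤ _ := by have := hd k; gcongr

omit [DecidableEq ι] in
theorem sum_dotProduct_edgeAdj_sq_le (hsym : ∀ k l, edge k l = edge l k)
    (hinj : ∀ k l l', edge k l = edge k l' → l = l') (hq : ∀ e, 0 ≤ q e) (hm : 0 < m)
    (hd : ∀ k, m ≤ ∑ l, q (edge k l)) (v : ι → ℝ) :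
    ∑ e, q e * (v ⬝ᵥ (((normalizedMatrix (fun k l => if edge k l = e then (1 : ℝ) else 0)
        fun k => ∑ l, q (edge k l)) * (normalizedMatrix
          (fun k l => if edge k l = e then (1 : ℝ) else 0) fun k => ∑ l, q (edge k l))).mulVec v))
      ≤ 1 / m * (v ⬝ᵥ v) := by
  set d : ι → ℝ := fun k => ∑ l, q (edge k l) with hdd
  have hd0 : ∀ k, 0 < d k := fun k => hm.trans_le (hd k)
  have h1 : ∀ e, q e * (v ⬝ᵥ (((normalizedMatrix (fun k l => if edge k l = e then (1 : ℝ) else 0)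
        d) * (normalizedMatrix
          (fun k l => if edge k l = e then (1 : ℝ) else 0) d)).mulVec v))
      ≤ ∑ k, q e * ∑ l, (if edge k l = e then (1 : ℝ) else 0) * (v l ^ 2 / (d l * m)) := by
    intro e
    rw [dotProduct_mul_self_mulVec (normalizedMatrix_isSymm (fun k l => by rw [hsym]) _),
      ← Finset.mul_sum]
    refine mul_le_mul_of_nonneg_left (Finset.sum_le_sum fun k _ => ?_) (hq e)
    have : (normalizedMatrix (fun k l => if edge k l = e then (1 : ℝ) else 0) d).mulVec v k
        = ∑ l, (if edge k l = e then (1 : ℝ) else 0)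
          * (v l / (Real.sqrt (d k) * Real.sqrt (d l))) := by
      simp only [Matrix.mulVec, dotProduct, normalizedMatrix, Matrix.of_apply]
      exact Finset.sum_congr rfl fun l _ => by ring
    rw [this]
    refine (sq_sum_ite_edge_mul_le hinj e k _).trans (Finset.sum_le_sum fun l _ => ?_)
    refine mul_le_mul_of_nonneg_left ?_ (by positivity)
    rw [div_pow, mul_pow, Real.sq_sqrt (hd0 k).le, Real.sq_sqrt (hd0 l).le, mul_comm (d k)]
    have := hd0 l
    have := hd k
    gcongr
  refine (Finset.sum_le_sum fun e _ => h1 e).trans ?_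
  rw [Finset.sum_comm]
  simp only [sum_mul_sum_ite_edge]
  rw [Finset.sum_comm, dotProduct, Finset.mul_sum]
  refine Finset.sum_le_sum fun l _ => le_of_eq ?_
  have h2 : ∑ k, q (edge k l) = d l := Finset.sum_congr rfl fun k _ => by rw [hsym]
  rw [← Finset.sum_mul, h2]
  have := (hd0 l).ne'
  field_simp

theorem dotProduct_diagonal_mulVec (g v : ι → ℝ) :
    v ⬝ᵥ (Matrix.diagonal g).mulVec v = ∑ k, g k * v k ^ 2 := by
  simp only [dotProduct, Matrix.mulVec_diagonal]
  exact Finset.sum_congr rfl fun k _ => by ring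

omit [Fintype E] in
theorem abs_dotProduct_edgeDeg_le (hinj : ∀ k l l', edge k l = edge k l' → l = l') {d : ι → ℝ}
    (hm : 0 < m) (hd : ∀ k, m ≤ d k) (e : E) (v : ι → ℝ) :
    |v ⬝ᵥ (Matrix.diagonal fun k => (∑ l, if edge k l = e then (1 : ℝ) else 0) / d k).mulVec v|
      ≤ 1 / m * (v ⬝ᵥ v) := by
  have hd0 : ∀ k, 0 < d k := fun k => hm.trans_le (hd k)
  have hr0 : ∀ k, 0 ≤ (∑ l, if edge k l = e then (1 : ℝ) else 0) / d k := fun k =>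
    div_nonneg (Finset.sum_nonneg fun l _ => by positivity) (hd0 k).le
  rw [dotProduct_diagonal_mulVec, abs_of_nonneg (Finset.sum_nonneg fun k _ =>
    mul_nonneg (hr0 k) (sq_nonneg _)), dotProduct, Finset.mul_sum]
  refine Finset.sum_le_sum fun k _ => ?_
  rw [← sq]
  exact mul_le_mul_of_nonneg_right (div_le_div₀ zero_le_one (sum_ite_edge_le_one hinj e k) hm
    (hd k)) (sq_nonneg _)

theorem sum_dotProduct_edgeDeg_sq_le (hinj : ∀ k l l', edge k l = edge k l' → l = l')
    (hq : ∀ e, 0 ≤ q e) (hm : 0 < m) (hd : ∀ k, m ≤ ∑ l, q (edge k l)) (v : ι → ℝ) :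
    ∑ e, q e * (v ⬝ᵥ (((Matrix.diagonal fun k =>
        (∑ l, if edge k l = e then (1 : ℝ) else 0) / ∑ l, q (edge k l)) * (Matrix.diagonal fun k =>
        (∑ l, if edge k l = e then (1 : ℝ) else 0) / ∑ l, q (edge k l))).mulVec v))
      ≤ 1 / m * (v ⬝ᵥ v) := by
  set d : ι → ℝ := fun k => ∑ l, q (edge k l) with hdd
  have hd0 : ∀ k, 0 < d k := fun k => hm.trans_le (hd k)
  have h1 : ∀ e, q e * (v ⬝ᵥ (((Matrix.diagonal fun k =>
        (∑ l, if edge k l = e then (1 : ℝ) else 0) / d k) * (Matrix.diagonal fun k =>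
        (∑ l, if edge k l = e then (1 : ℝ) else 0) / d k)).mulVec v))
      ≤ ∑ k, q e * ∑ l, (if edge k l = e then (1 : ℝ) else 0) * (v k ^ 2 / d k ^ 2) := by
    intro e
    rw [Matrix.diagonal_mul_diagonal, dotProduct_diagonal_mulVec, ← Finset.mul_sum]
    refine mul_le_mul_of_nonneg_left (Finset.sum_le_sum fun k _ => ?_) (hq e)
    rw [← Finset.sum_mul]
    have h2 := sum_ite_edge_le_one hinj e k
    have h3 : (0 : ℝ) ≤ ∑ l, if edge k l = e then (1 : ℝ) else 0 :=
      Finset.sum_nonneg fun l _ => by positivity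
    set r := ∑ l, if edge k l = e then (1 : ℝ) else 0
    calc _ = r * r * (v k ^ 2 / d k ^ 2) := by ring
      _ ≤ r * 1 * (v k ^ 2 / d k ^ 2) := by gcongr
      _ = _ := by ring
  refine (Finset.sum_le_sum fun e _ => h1 e).trans ?_
  rw [Finset.sum_comm, dotProduct, Finset.mul_sum]
  refine Finset.sum_le_sum fun k _ => ?_
  rw [sum_mul_sum_ite_edge q (fun _ => v k ^ 2 / d k ^ 2), ← Finset.sum_mul, ← sq]
  have h0 := hd0 k
  calc d k * (v k ^ 2 / d k ^ 2) = 1 / d k * v k ^ 2 := by field_simp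
    _ ≤ _ := by have := hd k; gcongr

/-- For independent edge weights with mean `q` and subexponential fluctuations `s`, the normalized
adjacency matrix and the degrees concentrate simultaneously. -/
theorem sum_prod_edge_bad_le {X : Type*} [Fintype X]
    (hsym : ∀ k l, edge k l = edge l k) (hinj : ∀ k l l', edge k l = edge k l' → l = l')
    (hq : ∀ e, 0 ≤ q e) (hm : 0 < m) (hd : ∀ k, m ≤ ∑ l, q (edge k l))
    {w s : E → X → ℝ} (hw : ∀ e x, 0 ≤ w e x) {K t : ℝ} (hK : 0 < K) (ht : 0 < t)
    (hmgf : ∀ e, ∀ l : ℝ, |l| ≤ t / (2 * K) →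
      ∑ x, w e x * Real.exp (s e x * l - K * q e * l ^ 2) ≤ 1) {bad : Finset (E → X)}
    (hbad : ∀ x ∈ bad, (∀ v, |v ⬝ᵥ (normalizedMatrix (fun k l => s (edge k l) (x (edge k l)))
      fun k => ∑ l, q (edge k l)).mulVec v| ≤ t * (v ⬝ᵥ v)) →
      ¬ ∀ k, |∑ l, s (edge k l) (x (edge k l))| ≤ t * ∑ l, q (edge k l)) :
    ∑ x ∈ bad, ∏ e, w e (x e)
      ≤ 4 * (Fintype.card ι * Real.exp (-(t ^ 2 * m / (4 * K)))) := by
  classical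
  set d : ι → ℝ := fun k => ∑ l, q (edge k l) with hdd
  have hd0 : ∀ k, 0 < d k := fun k => hm.trans_le (hd k)
  have hW : ∀ x : E → X, 0 ≤ ∏ e, w e (x e) := fun x => Finset.prod_nonneg fun e _ => hw e _
  have hadj := sum_prod_filter_abs_le hw hK ht hm hmgf
    (fun e => normalizedMatrix_isSymm (a := fun k l => if edge k l = e then (1 : ℝ) else 0)
      (fun k l => by rw [hsym]) d) (abs_dotProduct_edgeAdj_le hsym hinj hm hd)
    (sum_dotProduct_edgeAdj_sq_le hsym hinj hq hm hd)
    (bad := bad.filter fun x => ∃ v, t * (v ⬝ᵥ v) < |v ⬝ᵥ (normalizedMatrix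
      (fun k l => s (edge k l) (x (edge k l))) d).mulVec v|) (fun x hx => by
        obtain ⟨v, hv⟩ := (Finset.mem_filter.1 hx).2
        refine ⟨v, hv.trans_eq ?_⟩
        congr 3
        ext k l
        simp [Matrix.sum_apply, normalizedMatrix, Finset.sum_ite_eq, div_eq_mul_inv])
  have hdeg := sum_prod_filter_abs_le hw hK ht hm hmgf
    (fun e => Matrix.isSymm_diagonal
      fun k => (∑ l, if edge k l = e then (1 : ℝ) else 0) / d k)
    (abs_dotProduct_edgeDeg_le hinj hm hd) (sum_dotProduct_edgeDeg_sq_le hinj hq hm hd)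
    (bad := bad.filter fun x => ∃ k, t * d k < |∑ l, s (edge k l) (x (edge k l))|)
    (fun x hx => by
        obtain ⟨k, hk⟩ := (Finset.mem_filter.1 hx).2
        refine ⟨Pi.single k 1, ?_⟩
        have h1 : ∑ e, s e (x e) • Matrix.diagonal
            (fun k => (∑ l, if edge k l = e then (1 : ℝ) else 0) / d k)
            = Matrix.diagonal fun k => (∑ l, s (edge k l) (x (edge k l))) / d k := by
          ext i j
          rw [Matrix.sum_apply]
          by_cases hij : i = j
          · subst hij
            simp only [Matrix.smul_apply, Matrix.diagonal_apply_eq, smul_eq_mul]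
            have := sum_mul_sum_ite_edge (edge := edge) (fun e => s e (x e)) (fun _ => 1) i
            simp only [mul_one] at this
            rw [← this, Finset.sum_div]
            exact Finset.sum_congr rfl fun e _ => by ring
          · simp [hij]
        rw [h1]
        simp only [dotProduct_single, single_dotProduct, Matrix.mulVec_single_one, Matrix.col_apply,
          Matrix.diagonal_apply_eq, Pi.single_eq_same, mul_one, one_mul]
        rwa [abs_div, abs_of_pos (hd0 k), lt_div_iff₀ (hd0 k)])
  refine le_trans ?_ ((add_le_add hadj hdeg).trans_eq (by ring))
  rw [← Finset.sum_union_inter]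
  refine le_trans ?_ (le_add_of_nonneg_right (Finset.sum_nonneg fun x _ => hW x))
  refine Finset.sum_le_sum_of_subset_of_nonneg (fun x hx => ?_) fun x _ _ => hW x
  rw [Finset.mem_union, Finset.mem_filter, Finset.mem_filter]
  by_contra! hcon
  exact hbad x hx (hcon.1 hx) (hcon.2 hx)

end EdgeConcentration

section EdgeTrajectories

/-- Unordered pairs of vertices, represented by their increasing enumeration. -/
abbrev VertexPair (n : ℕ) : Type := {e : Fin n × Fin n // e.1 ≤ e.2}

/-- The unordered pair with members `k` and `l`. -/
def vertexPair {n : ℕ} (k l : Fin n) : VertexPair n := ⟨(min k l, max k l), min_le_max⟩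

theorem vertexPair_comm {n : ℕ} (k l : Fin n) : vertexPair k l = vertexPair l k := by
  simp [vertexPair, min_comm, max_comm]

theorem vertexPair_right_injective {n : ℕ} (k l l' : Fin n) (h : vertexPair k l = vertexPair k l') :
    l = l' := by
  simp only [vertexPair, Subtype.mk.injEq, Prod.mk.injEq] at h
  grind

theorem vertexPair_eq {n : ℕ} (e : VertexPair n) : vertexPair e.1.1 e.1.2 = e := by
  obtain ⟨⟨i, j⟩, h⟩ := e
  simp only [vertexPair, min_eq_left h, max_eq_right h]

theorem apply_vertexPair {n : ℕ} {β : Type*} {f : Fin n → Fin n → β} (hf : ∀ i j, f i j = f j i)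
    (k l : Fin n) : f (vertexPair k l).1.1 (vertexPair k l).1.2 = f k l := by
  rcases le_total k l with h | h
  · simp [vertexPair, h]
  · simp [vertexPair, h, hf l k]

/-- The trajectories of all edges over the times `1, …, N + 1`. -/
def edgeTraj {Ω : Type} {n : ℕ} (N : ℕ) (A : ℕ → Ω → Fin n → Fin n → Bool) (ω : Ω) :
    VertexPair n → Fin (N + 1) → Bool :=
  fun e t => A (t + 1) ω e.1.1 e.1.2

theorem prod_Icc_two_eq_prod_fin {M : Type*} [CommMonoid M] (f : ℕ → M) (N : ℕ) :
    ∏ t ∈ Finset.Icc 2 (N + 1), f t = ∏ t : Fin N, f (t + 2) := by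
  induction N with
  | zero => simp
  | succ N ih => rw [Finset.prod_Icc_succ_top (by omega), ih, Fin.prod_univ_castSucc]; simp

theorem sum_Icc_one_eq_sum_fin (f : ℕ → ℝ) (N : ℕ) :
    ∑ t ∈ Finset.Icc 1 N, f t = ∑ t : Fin N, f (t + 1) := by
  induction N with
  | zero => simp
  | succ N ih => rw [Finset.sum_Icc_succ_top (by omega), ih, Fin.sum_univ_castSucc]; simp

theorem sum_prod_mul_apply {E X : Type*} [Fintype E] [DecidableEq E] [Fintype X] {w : E → X → ℝ}
    (hw : ∀ e, ∑ x, w e x = 1) (e₀ : E) (f : X → ℝ) :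
    ∑ x : E → X, (∏ e, w e (x e)) * f (x e₀) = ∑ y, w e₀ y * f y := by
  have h1 : ∀ x : E → X, (∏ e, w e (x e)) * f (x e₀)
      = ∏ e, w e (x e) * (if e = e₀ then f (x e) else 1) := by
    intro x
    rw [Finset.prod_mul_distrib, Finset.prod_ite_eq']
    simp
  have h2 := Finset.prod_univ_sum (fun _ : E => (Finset.univ : Finset X))
    (fun e y => w e y * (if e = e₀ then f y else 1))
  rw [Fintype.piFinset_univ] at h2
  rw [Finset.sum_congr rfl fun x _ => h1 x, ← h2, Finset.prod_eq_single e₀]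
  · simp
  · intro e _ he
    simp [he, hw]
  · simp

theorem sum_chainProb (p α : ℝ) (N : ℕ) : ∑ y : Fin (N + 1) → Bool, chainProb p α y = 1 := by
  have h := sum_chainProb_mul p α fun _ : Fin (N + 1) → Bool => 1
  simp only [mul_one, chainExp_const] at h
  rw [h]
  simp [bernProb]

variable {Ω : Type} [MeasurableSpace Ω] {μ : Measure Ω} {n N : ℕ} {P : Matrix (Fin n) (Fin n) ℝ}
  {α : ℝ} {A : ℕ → Ω → Fin n → Fin n → Bool}

theorem IsLazyIER.measurable_edgeTraj (h : IsLazyIER μ n (N + 1) P α A) :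
    Measurable (edgeTraj N A) := by
  refine measurable_pi_iff.2 fun e => measurable_pi_iff.2 fun t => ?_
  exact measurable_pi_iff.1 (measurable_pi_iff.1 (h.meas (t + 1)) e.1.1) e.1.2

theorem IsLazyIER.map_edgeTraj_singleton (h : IsLazyIER μ n (N + 1) P α A)
    (x : VertexPair n → Fin (N + 1) → Bool) :
    (μ.map (edgeTraj N A)).real {x} = ∏ e, chainProb (P e.1.1 e.1.2) α (x e) := by
  rw [map_measureReal_apply h.measurable_edgeTraj (measurableSet_singleton x)]
  have hlaw := h.law (fun t i j => x (vertexPair i j) (Fin.ofNat (N + 1) (t - 1)))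
    fun t i j => by rw [vertexPair_comm]
  have hset : {ω | ∀ t ∈ Finset.Icc 1 (N + 1),
      A t ω = fun i j => x (vertexPair i j) (Fin.ofNat (N + 1) (t - 1))}
      = edgeTraj N A ⁻¹' {x} := by
    ext ω
    simp only [Set.mem_ofPred_eq, Set.mem_preimage, Set.mem_singleton_iff]
    constructor
    · intro hω
      funext e t
      have := congrFun (congrFun (hω (t + 1) (Finset.mem_Icc.2 ⟨by omega, by omega⟩)) e.1.1) e.1.2
      rw [edgeTraj, this, vertexPair_eq]
      simp
    · rintro rfl t ht
      rw [Finset.mem_Icc] at ht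
      funext i j
      have ht1 : (Fin.ofNat (N + 1) (t - 1) : ℕ) + 1 = t := by
        simp only [Fin.ofNat, Nat.mod_eq_of_lt (show t - 1 < N + 1 by omega)]
        omega
      rw [edgeTraj, apply_vertexPair (h.A_symm _ ω), ht1]
  rw [hset] at hlaw
  refine hlaw.trans ?_
  rw [lazyTrajProb, Finset.prod_subtype (p := fun e : Fin n × Fin n => e.1 ≤ e.2) _ (by simp)]
  refine Finset.prod_congr rfl fun e _ => ?_
  rw [prod_Icc_two_eq_prod_fin, vertexPair_eq, chainProb]
  congr 1
  refine Finset.prod_congr rfl fun t _ => ?_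
  congr 2
  · ext; simp [Fin.ofNat]
  · ext; simp [Fin.ofNat]

theorem IsLazyIER.integral_edgeTraj (h : IsLazyIER μ n (N + 1) P α A)
    (g : (VertexPair n → Fin (N + 1) → Bool) → ℝ) :
    ∫ ω, g (edgeTraj N A ω) ∂μ = ∑ x, (∏ e, chainProb (P e.1.1 e.1.2) α (x e)) * g x := by
  have := h.prob
  have := Measure.isProbabilityMeasure_map (μ := μ) h.measurable_edgeTraj.aemeasurable
  have hg : Measurable g := Measurable.of_discrete
  rw [← integral_map h.measurable_edgeTraj.aemeasurable hg.aestronglyMeasurable,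
    integral_fintype Integrable.of_finite]
  simp only [h.map_edgeTraj_singleton, smul_eq_mul]

theorem IsLazyIER.aggE_eq (h : IsLazyIER μ n (N + 1) P α A) (ω : Ω) (i j : Fin n) :
    aggE n (N + 1) A ω i j = trueCount (edgeTraj N A ω (vertexPair i j)) := by
  rw [aggE, sum_Icc_one_eq_sum_fin, trueCount]
  refine Finset.sum_congr rfl fun t _ => ?_
  rw [edgeTraj, apply_vertexPair (h.A_symm _ ω)]

theorem IsLazyIER.aggMean_eq (h : IsLazyIER μ n (N + 1) P α A) (i j : Fin n) :
    aggMean μ n (N + 1) A i j = (N + 1) * P i j := by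
  simp only [aggMean, Matrix.of_apply, h.aggE_eq]
  rw [h.integral_edgeTraj fun x => trueCount (x (vertexPair i j)),
    sum_prod_mul_apply (w := fun e : VertexPair n => chainProb (P e.1.1 e.1.2) α)
      (fun e => sum_chainProb _ _ _) (vertexPair i j) trueCount,
    sum_chainProb_mul_trueCount, apply_vertexPair h.P_symm]

theorem IsLazyIER.one_sub_le_measureReal (h : IsLazyIER μ n (N + 1) P α A) {δ : ℝ}
    {good : Set (VertexPair n → Fin (N + 1) → Bool)}
    {bad : Finset (VertexPair n → Fin (N + 1) → Bool)}
    (hbad : ∀ x, x ∉ bad → x ∈ good)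
    (hδ : ∑ x ∈ bad, ∏ e, chainProb (P e.1.1 e.1.2) α (x e) ≤ δ) :
    1 - δ ≤ μ.real (edgeTraj N A ⁻¹' good) := by
  have := h.prob
  have := Measure.isProbabilityMeasure_map (μ := μ) h.measurable_edgeTraj.aemeasurable
  rw [← map_measureReal_apply h.measurable_edgeTraj (Set.toFinite _).measurableSet]
  have h1 : (μ.map (edgeTraj N A)).real (bad : Set (VertexPair n → Fin (N + 1) → Bool)) ≤ δ := by
    rw [← sum_measureReal_singleton]
    simpa only [h.map_edgeTraj_singleton] using hδ
  have h2 := probReal_compl_eq_one_sub (μ := μ.map (edgeTraj N A)) bad.measurableSet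
  have h3 : (μ.map (edgeTraj N A)).real (bad : Set (VertexPair n → Fin (N + 1) → Bool))ᶜ
      ≤ (μ.map (edgeTraj N A)).real good := measureReal_mono fun x hx => hbad x hx
  linarith

end EdgeTrajectories

section Laplacian

open scoped Matrix.Norms.L2Operator

variable {Ω : Type} [MeasurableSpace Ω] {μ : Measure Ω} {n N : ℕ} {P : Matrix (Fin n) (Fin n) ℝ}
  {α : ℝ} {A : ℕ → Ω → Fin n → Fin n → Bool}

theorem IsLazyIER.opNorm_aggLap_sub_eq (h : IsLazyIER μ n (N + 1) P α A) (ω : Ω) :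
    opNorm (aggLap n (N + 1) A ω - aggLapMean μ n (N + 1) A)
      = opNorm ((normalizedMatrix (fun k l => trueCount (edgeTraj N A ω (vertexPair k l)))
          fun k => ∑ l, trueCount (edgeTraj N A ω (vertexPair k l)))
        - normalizedMatrix (fun k l => (N + 1) * P k l) fun k => ∑ l, (N + 1) * P k l) := by
  have h1 : aggLap n (N + 1) A ω - aggLapMean μ n (N + 1) A
      = -((normalizedMatrix (fun k l => trueCount (edgeTraj N A ω (vertexPair k l)))
          fun k => ∑ l, trueCount (edgeTraj N A ω (vertexPair k l)))
        - normalizedMatrix (fun k l => (N + 1) * P k l) fun k => ∑ l, (N + 1) * P k l) := by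
    simp only [aggLap, aggLapMean, aggDeg, aggMeanDeg, h.aggE_eq, h.aggMean_eq, normalizedMatrix]
    abel
  rw [h1, opNorm_eq_norm, opNorm_eq_norm, norm_neg]

theorem trueCount_nonneg {N : ℕ} (y : Fin N → Bool) : 0 ≤ trueCount y :=
  Finset.sum_nonneg fun t _ => by positivity

theorem dMin_le_sum (P : Matrix (Fin n) (Fin n) ℝ) (k : Fin n) : dMin P ≤ ∑ l, P k l :=
  ciInf_le (Set.finite_range _).bddBelow k

/-- The aggregated Laplacian deviates by more than `4 t` from its mean counterpart with probability
at most `4 n exp (-t² T d_min (1 - α)² / 24)`. -/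
theorem IsLazyIER.one_sub_le_measureReal_opNorm_le (h : IsLazyIER μ n (N + 1) P α A) {t : ℝ}
    (ht : 0 < t) (hm : 0 < (N + 1) * dMin P) :
    1 - 4 * (n * Real.exp (-(t ^ 2 * ((N + 1) * dMin P) / (4 * (6 / (1 - α) ^ 2)))))
      ≤ μ.real {ω | opNorm (aggLap n (N + 1) A ω - aggLapMean μ n (N + 1) A) ≤ 4 * t} := by
  classical
  have hγ : 0 < 1 - α := by linarith [h.alpha_mem.2]
  set K : ℝ := 6 / (1 - α) ^ 2 with hKdef
  have hK : 0 < K := by positivity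
  have hN : (0 : ℝ) < N + 1 := by positivity
  have hsa : ∀ x : VertexPair n → Fin (N + 1) → Bool, ∀ k l,
      trueCount (x (vertexPair k l)) = trueCount (x (vertexPair l k)) := fun x k l => by
    rw [vertexPair_comm]
  have hsb : ∀ k l, (N + 1) * P k l = (N + 1) * P l k := fun k l => by rw [h.P_symm]
  have hb : ∀ k l, 0 ≤ (N + 1) * P k l := fun k l => mul_nonneg hN.le (h.P_mem k l).1
  have hd : ∀ k, (N + 1) * dMin P ≤ ∑ l, (N + 1) * P k l := fun k => by
    rw [← Finset.mul_sum]
    exact mul_le_mul_of_nonneg_left (dMin_le_sum P k) hN.le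
  have hset : {ω | opNorm (aggLap n (N + 1) A ω - aggLapMean μ n (N + 1) A) ≤ 4 * t}
      = edgeTraj N A ⁻¹' {x | opNorm ((normalizedMatrix
          (fun k l => trueCount (x (vertexPair k l)))
          fun k => ∑ l, trueCount (x (vertexPair k l)))
        - normalizedMatrix (fun k l => (N + 1) * P k l) fun k => ∑ l, (N + 1) * P k l)
          ≤ 4 * t} := by
    ext ω
    simp only [Set.mem_ofPred_eq, Set.mem_preimage, h.opNorm_aggLap_sub_eq]
  rw [hset]
  rcases le_or_gt t 1 with h1 | h1
  · set q : VertexPair n → ℝ := fun e => (N + 1) * P e.1.1 e.1.2 with hq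
    have hqe : ∀ k l, q (vertexPair k l) = (N + 1) * P k l := fun k l => by
      rw [hq]
      exact congrArg _ (apply_vertexPair (f := P) h.P_symm k l)
    set w : VertexPair n → (Fin (N + 1) → Bool) → ℝ := fun e => chainProb (P e.1.1 e.1.2) α with hw
    refine h.one_sub_le_measureReal (bad := Finset.univ.filter fun x =>
      (∀ v, |v ⬝ᵥ (normalizedMatrix (fun k l => trueCount (x (vertexPair k l))
        - q (vertexPair k l)) fun k => ∑ l, q (vertexPair k l)).mulVec v| ≤ t * (v ⬝ᵥ v)) →
      ¬ ∀ k, |∑ l, (trueCount (x (vertexPair k l)) - q (vertexPair k l))|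
        ≤ t * ∑ l, q (vertexPair k l)) (fun x hx => ?_) ?_
    · simp only [Finset.mem_filter, Finset.mem_univ, true_and, Classical.not_imp, not_not, hqe,
        Finset.sum_sub_distrib] at hx
      simp only [Set.mem_ofPred_eq, opNorm_eq_norm]
      exact norm_normalizedMatrix_sub_le (hsa x) hsb (fun k l => trueCount_nonneg _) hb
        (fun k => hm.trans_le (hd k)) ht.le hx.1 hx.2
    · have key := sum_prod_edge_bad_le (edge := vertexPair (n := n)) (q := q)
        (s := fun e y => trueCount y - q e) (w := w) (K := K) (t := t)
        (bad := Finset.univ.filter fun x =>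
          (∀ v, |v ⬝ᵥ (normalizedMatrix (fun k l => trueCount (x (vertexPair k l))
            - q (vertexPair k l)) fun k => ∑ l, q (vertexPair k l)).mulVec v| ≤ t * (v ⬝ᵥ v)) →
          ¬ ∀ k, |∑ l, (trueCount (x (vertexPair k l)) - q (vertexPair k l))|
            ≤ t * ∑ l, q (vertexPair k l))
        vertexPair_comm vertexPair_right_injective (fun e => hb _ _) hm
        (fun k => by simpa only [hqe] using hd k)
        (fun e y => chainProb_nonneg (h.P_mem _ _) h.alpha_mem y) hK ht
        (fun e l hl => sum_chainProb_mul_exp_centered_le (h.P_mem _ _) h.alpha_mem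
          (hl.trans ?_) N) (fun x hx => (Finset.mem_filter.1 hx).2)
      · simpa only [Fintype.card_fin] using key
      · have hα := h.alpha_mem.1
        rw [hKdef, div_le_iff₀ (by positivity)]
        have : (1 - α) / 4 * (2 * (6 / (1 - α) ^ 2)) = 3 / (1 - α) := by field_simp; norm_num
        rw [this, le_div_iff₀ hγ]
        nlinarith
  · have hle := h.one_sub_le_measureReal (bad := ∅) (δ := 0) (good := {x | opNorm ((normalizedMatrix
          (fun k l => trueCount (x (vertexPair k l)))
          fun k => ∑ l, trueCount (x (vertexPair k l)))
        - normalizedMatrix (fun k l => (N + 1) * P k l) fun k => ∑ l, (N + 1) * P k l)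
          ≤ 4 * t}) (fun x _ => by
        have e1 := norm_normalizedMatrix_le_one (hsa x) fun k l => trueCount_nonneg _
        have e2 := norm_normalizedMatrix_le_one hsb hb
        have e3 := norm_sub_le (normalizedMatrix
          (fun k l => trueCount (x (vertexPair k l)))
          fun k => ∑ l, trueCount (x (vertexPair k l)))
          (normalizedMatrix (fun k l => (N + 1) * P k l) fun k => ∑ l, (N + 1) * P k l)
        rw [Set.mem_ofPred_eq, opNorm_eq_norm]
        linarith) (by simp)
    refine le_trans (sub_le_sub_left ?_ 1) hle
    positivity

end Laplacian

/-- **Theorem (concentration of the aggregated Laplacian matrix).**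
For any constant `c > 0` there exists a constant `C = C(c) > 0` (independent of
`n, T, P, α`) such that: if `T·d_min > C (log n)^3`, then there is a constant
`C₂ = C₂(α)` such that for every `δ ∈ (n^{-c}, 1/2)`, with probability at least
`1 - δ`, `‖𝓛 - 𝓛̄‖ ≤ C₂ √(log(4n/δ) / (T·d_min))`. -/
theorem lazyIER_aggLap_concentration :
    ∀ c : ℝ, 0 < c → ∃ C : ℝ, 0 < C ∧
      ∀ α : ℝ, α ∈ Set.Ioo (0 : ℝ) 1 →
        ∃ C₂ : ℝ,
          ∀ (n T : ℕ) (P : Matrix (Fin n) (Fin n) ℝ)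
            (Ω : Type) (_ : MeasurableSpace Ω) (μ : Measure Ω)
            (A : ℕ → Ω → Fin n → Fin n → Bool),
            IsLazyIER μ n T P α A →
            (T : ℝ) * dMin P > C * (Real.log n) ^ 3 →
            ∀ δ : ℝ, (n : ℝ) ^ (-c) < δ → δ < 1 / 2 →
              (μ {ω | opNorm (aggLap n T A ω - aggLapMean μ n T A) ≤
                  C₂ * Real.sqrt (Real.log ((4 * n : ℝ) / δ) / ((T : ℝ) * dMin P))}).toReal
                ≥ 1 - δ := by
  intro c hc
  refine ⟨1, one_pos, fun α hα => ⟨4 * Real.sqrt (4 * (6 / (1 - α) ^ 2)), ?_⟩⟩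
  intro n T P Ω _ μ A h hT δ hδ hδ2
  obtain ⟨N, rfl⟩ : ∃ N, T = N + 1 := ⟨T - 1, by have := h.two_le_T; omega⟩
  have hγ : 0 < 1 - α := by linarith [hα.2]
  push_cast at hT ⊢
  have hm : 0 < ((N : ℝ) + 1) * dMin P := by
    have : 0 ≤ Real.log n := Real.log_natCast_nonneg n
    have : 0 ≤ 1 * Real.log n ^ 3 := by positivity
    linarith
  have hn : 0 < n := by
    rcases Nat.eq_zero_or_pos n with rfl | hn
    · simp [dMin] at hm
    · exact hn
  have hn1 : (1 : ℝ) ≤ n := by exact_mod_cast hn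
  have hδ0 : 0 < δ := (Real.rpow_pos_of_pos (by linarith) _).trans hδ
  have hL : 0 < Real.log (4 * n / δ) := by
    refine Real.log_pos ?_
    rw [lt_div_iff₀ hδ0]
    linarith
  set K : ℝ := 6 / (1 - α) ^ 2 with hK
  have hK0 : 0 < K := by positivity
  set m : ℝ := ((N : ℝ) + 1) * dMin P with hmdef
  have hmain := h.one_sub_le_measureReal_opNorm_le
    (t := Real.sqrt (4 * K) * Real.sqrt (Real.log (4 * n / δ) / m)) (by positivity) hm
  rw [← hK, ← hmdef, ← mul_assoc 4 (Real.sqrt _)] at hmain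
  refine ge_iff_le.2 (le_trans (le_of_eq ?_) hmain)
  have h1 : (Real.sqrt (4 * K) * Real.sqrt (Real.log (4 * n / δ) / m)) ^ 2 * m / (4 * K)
      = Real.log (4 * n / δ) := by
    rw [mul_pow, Real.sq_sqrt (by positivity), Real.sq_sqrt (by positivity)]
    field_simp
  rw [h1, Real.exp_neg, Real.exp_log (by positivity)]
  field_simp
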